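/- Let f : ℕ → ℂ be in the class F₀, and let N ≥ 1 be a fixed integer. Then Σ_{n ≤ x} f(n) = x·log log x + C_f·x + x·Σ_{j=1}^{N} a_j / (log x)^j + O( x / (log x)^{N+1} ) as x → ∞, where C_f = γ + Σ_p ( log(1 − 1/p) + (1 − 1/p)·Σ_{ν=1}^{∞} f(p^ν)/p^ν ) (the sum over all primes p, absolutely convergent), and a_j = − ∫_1^∞ (t − ⌊t⌋)·(log t)^{j−1} / t² dt for 1 ≤ j ≤ N. The big-O means: there exist constants c > 0 and x₀ ≥ 3 so that the difference has modulus at most c·x/(log x)^{N+1} for all x ≥ x₀. -/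

import Mathlib

section
open Complex Set Filter Topology MeasureTheory Asymptotics

noncomputable def zfr : ℝ → ℂ := Set.indicator (Set.Ioi 1) (fun u => ((u - (⌊u⌋₊ : ℝ) : ℝ) : ℂ))

lemma fr_meas : Measurable (fun u : ℝ => u - (⌊u⌋₊ : ℝ)) := by
  exact measurable_id.sub (measurable_from_nat.comp Nat.measurable_floor)

lemma fr_nonneg {u : ℝ} (hu : 0 ≤ u) : 0 ≤ u - (⌊u⌋₊ : ℝ) := sub_nonneg.2 (Nat.floor_le hu)
lemma fr_le {u : ℝ} : u - (⌊u⌋₊ : ℝ) ≤ 1 := by linarith [Nat.lt_floor_add_one u]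

lemma zfr_norm (u : ℝ) : ‖zfr u‖ ≤ 1 := by
  unfold zfr
  by_cases hu : u ∈ Set.Ioi (1:ℝ)
  · rw [Set.indicator_of_mem hu, Complex.norm_real, Real.norm_of_nonneg]
    · exact fr_le
    · exact fr_nonneg (by have : 1 < u := hu; linarith)
  · rw [Set.indicator_of_notMem hu]; simp

lemma zfr_meas : Measurable zfr := by
  unfold zfr
  exact (Complex.measurable_ofReal.comp fr_meas).indicator measurableSet_Ioi

lemma zfr_diff {s : ℂ} (hs : s.re < 0) : DifferentiableAt ℂ (mellin zfr) s := by
  refine mellin_differentiableAt_of_isBigO_rpow (a := 0) (b := s.re - 1) ?_ ?_ hs ?_ (by linarith)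
  · apply LocallyIntegrable.locallyIntegrableOn
    have : LocallyIntegrable (fun _ : ℝ => (1:ℝ)) := locallyIntegrable_const _
    refine this.mono zfr_meas.aestronglyMeasurable ?_
    filter_upwards with u
    simpa using zfr_norm u
  · refine IsBigO.of_bound 1 ?_
    filter_upwards with u
    simpa using zfr_norm u
  · refine IsBigO.of_bound 1 ?_
    have : Set.Ioo (0:ℝ) 1 ∈ 𝓝[>] (0:ℝ) := Ioo_mem_nhdsGT one_pos
    filter_upwards [this] with u hu
    have : zfr u = 0 := by
      unfold zfr; rw [Set.indicator_of_notMem]; simp [hu.2.le]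
    rw [this]; simp

lemma mellin_zfr (s : ℂ) : mellin zfr (-s) =
    ∫ u in Set.Ioi (1:ℝ), ((u - (⌊u⌋₊ : ℝ) : ℝ) : ℂ) * (u : ℂ) ^ (-(s+1)) := by
  unfold mellin zfr
  have : ∀ u : ℝ, (u:ℂ) ^ (-s - 1) • Set.indicator (Set.Ioi 1) (fun u : ℝ => ((u - (⌊u⌋₊ : ℝ) : ℝ) : ℂ)) u
      = Set.indicator (Set.Ioi 1) (fun u : ℝ => ((u - (⌊u⌋₊ : ℝ) : ℝ) : ℂ) * (u : ℂ) ^ (-(s+1))) u := by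
    intro u
    by_cases hu : u ∈ Set.Ioi (1:ℝ)
    · rw [Set.indicator_of_mem hu, Set.indicator_of_mem hu, smul_eq_mul, mul_comm]
      congr 2; ring
    · rw [Set.indicator_of_notMem hu, Set.indicator_of_notMem hu]; simp
  simp_rw [this]
  rw [MeasureTheory.setIntegral_indicator measurableSet_Ioi]
  rw [Set.inter_eq_right.2 (Set.Ioi_subset_Ioi zero_le_one)]

lemma fr_integrable {s : ℂ} (hs : 0 < s.re) {a : ℝ} (ha : 0 < a) : IntegrableOn
    (fun u : ℝ => ((u - (⌊u⌋₊ : ℝ) : ℝ) : ℂ) * (u : ℂ) ^ (-(s+1))) (Set.Ioi a) := by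
  have h1 : IntegrableOn (fun u : ℝ => (u : ℂ) ^ (-(s+1))) (Set.Ioi a) := by
    apply integrableOn_Ioi_cpow_of_lt _ ha
    simp; linarith
  have h1' : IntegrableOn (fun u : ℝ => ‖(u : ℂ) ^ (-(s+1))‖) (Set.Ioi a) := h1.norm
  refine Integrable.mono' h1' ?_ ?_
  · exact (Complex.measurable_ofReal.comp fr_meas).aestronglyMeasurable.mul h1.aestronglyMeasurable
  · filter_upwards [self_mem_ae_restrict measurableSet_Ioi] with u hu
    have hu : a < u := hu
    rw [norm_mul, Complex.norm_real, Real.norm_of_nonneg (fr_nonneg (by linarith))]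
    exact mul_le_of_le_one_left (norm_nonneg _) fr_le

lemma zeta_int_right {s : ℂ} (hs : 1 < s.re) :
    riemannZeta s = s / (s - 1) - s * mellin zfr (-s) := by
  have h := LSeries_eq_mul_integral_of_nonneg (fun _ => 1) (r := 1) zero_le_one (s := s) hs
    (by simp; exact isBigO_refl _ _) (fun _ => zero_le_one)
  have e : LSeries (fun _ => ((1:ℝ):ℂ)) s = riemannZeta s := by
    have := LSeries_one_eq_riemannZeta hs
    rw [← this]; simp; rfl
  rw [e] at h
  rw [h, mellin_zfr]
  have hi : IntegrableOn (fun u : ℝ => (u : ℂ) ^ (-s)) (Set.Ioi 1) := by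
    apply integrableOn_Ioi_cpow_of_lt _ one_pos
    simpa using hs
  have hval : ∫ u in Set.Ioi (1:ℝ), (u : ℂ) ^ (-s) = 1 / (s - 1) := by
    rw [integral_Ioi_cpow_of_lt (by simpa using hs) one_pos]
    simp
    have h1 : -s + 1 ≠ 0 := by
      intro h
      have := congrArg Complex.re h
      simp at this; linarith
    have h2 : s - 1 ≠ 0 := by
      intro h; apply h1; linear_combination -h
    field_simp
    ring
  have : ∫ t in Set.Ioi (1:ℝ), (∑ k ∈ Finset.Icc 1 ⌊t⌋₊, ((1:ℝ) : ℂ)) * (t:ℂ) ^ (-(s + 1)) =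
     ∫ t in Set.Ioi (1:ℝ), ((t:ℂ) ^ (-s) - ((t - (⌊t⌋₊ : ℝ) : ℝ) : ℂ) * (t : ℂ) ^ (-(s+1))) := by
    apply setIntegral_congr_fun measurableSet_Ioi
    intro t ht
    have ht : 1 < t := ht
    have h0 : (t:ℂ) ≠ 0 := by exact_mod_cast (by linarith : t ≠ 0)
    have : (t:ℂ) ^ (-s) = t * (t:ℂ) ^ (-(s+1)) := by
      rw [show -s = 1 + (-(s+1)) by ring, Complex.cpow_add _ _ h0, Complex.cpow_one]
    simp only [Finset.sum_const, Nat.card_Icc, this]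
    push_cast
    simp
    ring
  rw [this, integral_sub hi (fr_integrable (by linarith) one_pos), hval]
  ring

lemma zeta_int {s : ℂ} (hs : 0 < s.re) (hs' : 0 < s.im) :
    riemannZeta s = s / (s - 1) - s * mellin zfr (-s) := by
  let U : Set ℂ := {z | 0 < z.re} ∩ {z | 0 < z.im}
  have hU : IsOpen U := (isOpen_lt continuous_const continuous_re).inter
    (isOpen_lt continuous_const continuous_im)
  have hne : ∀ z ∈ U, z ≠ 1 := by
    rintro z ⟨_, h2⟩ rfl; simp at h2
  have hc : IsPreconnected U := by
    apply Convex.isPreconnected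
    exact (convex_halfSpace_re_gt 0).inter (convex_halfSpace_im_gt 0)
  have h1 : AnalyticOnNhd ℂ riemannZeta U := by
    apply DifferentiableOn.analyticOnNhd _ hU
    intro z hz
    exact (differentiableAt_riemannZeta (hne z hz)).differentiableWithinAt
  have h2 : AnalyticOnNhd ℂ (fun s => s / (s - 1) - s * mellin zfr (-s)) U := by
    apply DifferentiableOn.analyticOnNhd _ hU
    intro z hz
    have : z - 1 ≠ 0 := sub_ne_zero.2 (hne z hz)
    have h3 : DifferentiableAt ℂ (fun s => mellin zfr (-s)) z := by
      have : DifferentiableAt ℂ (mellin zfr) (-z) := zfr_diff (by simpa using hz.1)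
      exact this.comp z differentiableAt_id.neg
    apply DifferentiableAt.differentiableWithinAt
    fun_prop (disch := assumption)
  have h4 := h1.eqOn_of_preconnected_of_eventuallyEq h2 hc (z₀ := 2 + I) (by simp [U]) (by
    have : {z : ℂ | 1 < z.re} ∈ 𝓝 (2 + I) := 
      (isOpen_lt continuous_const continuous_re).mem_nhds (by simp)
    filter_upwards [this] with z hz
    exact zeta_int_right hz)
  exact h4 ⟨hs, hs'⟩


lemma fin_abel {s : ℂ} (hs : s ≠ 0) (N : ℕ) : ∑ k ∈ Finset.Icc 1 N, (k:ℂ)^(-s) =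
    (N:ℂ)^(-s) * N + s * ∫ t in Set.Ioc (1:ℝ) N, (⌊t⌋₊ : ℂ) * (t:ℂ) ^ (-(s+1)) := by
  have hd : ∀ t ∈ Set.Icc (1:ℝ) N, HasDerivAt (fun t : ℝ => (t:ℂ)^(-s)) (-s * (t:ℂ)^(-(s+1))) t := by
    intro t ht
    have := (hasDerivAt_ofReal_cpow_const (x := t) (r := -s) (by linarith [ht.1])
      (by simpa using hs))
    rwa [show -s - 1 = -(s+1) by ring] at this
  have hde : ∀ t ∈ Set.Icc (1:ℝ) N, deriv (fun t : ℝ => (t:ℂ)^(-s)) t = -s * (t:ℂ)^(-(s+1)) :=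
    fun t ht => (hd t ht).deriv
  have hcont : ContinuousOn (fun t : ℝ => -s * (t:ℂ)^(-(s+1))) (Set.Icc (1:ℝ) N) := by
    refine continuousOn_const.mul ?_
    refine ContinuousOn.cpow_const (by fun_prop) ?_
    intro t ht
    exact Complex.ofReal_mem_slitPlane.2 (by linarith [ht.1])
  have h := sum_mul_eq_sub_integral_mul₀' (f := fun t : ℝ => (t:ℂ)^(-s))
    (fun k : ℕ => if k = 0 then (0:ℂ) else 1) (by simp) N
    (fun t ht => (hd t ht).differentiableAt)
    (by
      refine (integrableOn_congr_fun hde measurableSet_Icc).2 ?_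
      exact hcont.integrableOn_Icc)
  have hcount : ∀ m : ℕ, ∑ k ∈ Finset.Icc 0 m, (if k = 0 then (0:ℂ) else 1) = m := by
    intro m
    induction m with
    | zero => simp
    | succ n ih => rw [Finset.sum_Icc_succ_top (by omega), ih]; simp
  have hl : ∑ k ∈ Finset.Icc 0 N, (fun t : ℝ => (t:ℂ)^(-s)) k * (if k = 0 then (0:ℂ) else 1)
      = ∑ k ∈ Finset.Icc 1 N, (k:ℂ)^(-s) := by
    rw [Finset.Icc_eq_cons_Ioc (Nat.zero_le _), Finset.sum_cons]
    simp only [if_true, mul_zero, zero_add]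
    apply Finset.sum_congr rfl
    intro k hk
    have : k ≠ 0 := by have := (Finset.mem_Ioc.1 hk).1; omega
    simp [this]
  rw [hl] at h
  rw [h, hcount]
  have : ∫ t in Set.Ioc (1:ℝ) N, deriv (fun t : ℝ => (t:ℂ)^(-s)) t * ∑ k ∈ Finset.Icc 0 ⌊t⌋₊, (if k = 0 then (0:ℂ) else 1)
    = ∫ t in Set.Ioc (1:ℝ) N, (-s) * ((⌊t⌋₊ : ℂ) * (t:ℂ) ^ (-(s+1))) := by
    apply setIntegral_congr_fun measurableSet_Ioc
    intro t ht
    simp only [hcount]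
    rw [hde t ⟨ht.1.le, ht.2⟩]; ring
  rw [this, integral_const_mul]
  simp

lemma zeta_split {s : ℂ} (hs : 0 < s.re) (hs' : 0 < s.im) {N : ℕ} (hN : 1 ≤ N) :
    riemannZeta s = ∑ k ∈ Finset.Icc 1 N, (k:ℂ)^(-s) + (N:ℂ)^(1-s) / (s-1)
      - s * ∫ u in Set.Ioi (N:ℝ), ((u - (⌊u⌋₊ : ℝ) : ℝ) : ℂ) * (u : ℂ) ^ (-(s+1)) := by
  have hN' : (1:ℝ) ≤ N := by exact_mod_cast hN
  have hs0 : s ≠ 0 := by rintro rfl; simp at hs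
  have hs1 : s - 1 ≠ 0 := by intro h; have := congrArg Complex.im h; simp at this; linarith
  have hN0 : (N:ℂ) ≠ 0 := by exact_mod_cast (by omega : N ≠ 0)
  rw [zeta_int hs hs', mellin_zfr, fin_abel hs0]
  have hu : Set.Ioi (1:ℝ) = Set.Ioc 1 (N:ℝ) ∪ Set.Ioi (N:ℝ) := (Set.Ioc_union_Ioi_eq_Ioi hN').symm
  have hI := fr_integrable hs one_pos
  have hI1 := hI.mono_set (Set.Ioc_subset_Ioi_self : Set.Ioc (1:ℝ) N ⊆ _)
  rw [hu, setIntegral_union (Set.Ioc_disjoint_Ioi le_rfl) measurableSet_Ioi hI1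
    (hI.mono_set (Set.Ioi_subset_Ioi hN'))]
  have hc : ∫ t in Set.Ioc (1:ℝ) N, (t:ℂ)^(-s) = ((N:ℂ)^(1-s) - 1)/(1 - s) := by
    rw [← intervalIntegral.integral_of_le hN', integral_cpow]
    · simp [show -s + 1 = 1 - s by ring]
    · right
      refine ⟨by intro h; apply hs1; linear_combination -h, ?_⟩
      rw [Set.uIcc_of_le hN']; simp
  have hci : IntegrableOn (fun t : ℝ => (t:ℂ)^(-s)) (Set.Ioc (1:ℝ) N) := by
    apply (ContinuousOn.integrableOn_Icc _).mono_set Set.Ioc_subset_Icc_self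
    refine ContinuousOn.cpow_const (by fun_prop) ?_
    intro t ht
    exact Complex.ofReal_mem_slitPlane.2 (by linarith [ht.1])
  have : ∫ t in Set.Ioc (1:ℝ) N, (⌊t⌋₊ : ℂ) * (t:ℂ) ^ (-(s+1)) =
     ∫ t in Set.Ioc (1:ℝ) N, ((t:ℂ) ^ (-s) - ((t - (⌊t⌋₊ : ℝ) : ℝ) : ℂ) * (t : ℂ) ^ (-(s+1))) := by
    apply setIntegral_congr_fun measurableSet_Ioc
    intro t ht
    have h0 : (t:ℂ) ≠ 0 := by exact_mod_cast (by linarith [ht.1] : t ≠ 0)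
    have : (t:ℂ) ^ (-s) = t * (t:ℂ) ^ (-(s+1)) := by
      rw [show -s = 1 + (-(s+1)) by ring, Complex.cpow_add _ _ h0, Complex.cpow_one]
    simp only [this]
    push_cast
    ring
  rw [this, integral_sub hci hI1, hc]
  have e : (N:ℂ)^(1-s) = (N:ℂ)^(-s) * N := by
    rw [show 1 - s = -s + 1 by ring, Complex.cpow_add _ _ hN0, Complex.cpow_one]
  rw [← e]
  have hs2 : 1 - s ≠ 0 := by intro h; apply hs1; linear_combination -h
  field_simp
  ring

lemma zeta_bound_pos {ε : ℝ} (h0 : 0 < ε) (h1 : ε ≤ 1/4) : ∃ C > 0, ∀ s : ℂ, 1 - ε ≤ s.re →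
    s.re ≤ 3 → 1 ≤ s.im → ‖riemannZeta s‖ ≤ C * s.im ^ (2*ε) := by
  have hsum : Summable (fun k : ℕ => (k:ℝ)^(-(1+ε))) := Real.summable_nat_rpow.2 (by linarith)
  set C1 := ∑' k : ℕ, (k:ℝ)^(-(1+ε)) with hC1
  have hC1' : 0 ≤ C1 := tsum_nonneg (fun k => by positivity)
  refine ⟨2 * (C1 + 9), by positivity, ?_⟩
  intro s hs hs3 ht
  set t := s.im
  set N := ⌈t⌉₊ with hNd
  have hNt : t ≤ N := Nat.le_ceil t
  have hN1 : 1 ≤ N := by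
    have : (1:ℝ) ≤ N := ht.trans hNt
    exact_mod_cast this
  have hN1' : (1:ℝ) ≤ N := by exact_mod_cast hN1
  have hN2 : (N:ℝ) ≤ 2 * t := by linarith [Nat.ceil_lt_add_one (by linarith : 0 ≤ t)]
  have hσ : 0 < s.re := by linarith
  rw [zeta_split hσ (by linarith) hN1]
  have b1 : ‖∑ k ∈ Finset.Icc 1 N, (k:ℂ)^(-s)‖ ≤ C1 * (N:ℝ)^(2*ε) := by
    calc ‖∑ k ∈ Finset.Icc 1 N, (k:ℂ)^(-s)‖ ≤ ∑ k ∈ Finset.Icc 1 N, (k:ℝ)^(-(1+ε)) * (N:ℝ)^(2*ε) := by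
          apply norm_sum_le_of_le
          intro k hk
          have hk1 := (Finset.mem_Icc.1 hk).1
          have hk1' : (1:ℝ) ≤ k := by exact_mod_cast hk1
          have hk2 : (k:ℝ) ≤ N := by exact_mod_cast (Finset.mem_Icc.1 hk).2
          rw [Complex.norm_natCast_cpow_of_pos (by omega)]
          calc (k:ℝ)^((-s).re) ≤ (k:ℝ)^(-(1+ε) + 2*ε) := by
                apply Real.rpow_le_rpow_of_exponent_le hk1'
                simp; linarith
            _ = (k:ℝ)^(-(1+ε)) * (k:ℝ)^(2*ε) := Real.rpow_add (by linarith) _ _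
            _ ≤ _ := by gcongr
      _ = (∑ k ∈ Finset.Icc 1 N, (k:ℝ)^(-(1+ε))) * (N:ℝ)^(2*ε) := by rw [Finset.sum_mul]
      _ ≤ _ := by
          gcongr
          exact hsum.sum_le_tsum _ (fun k _ => by positivity)
  have hNe : (N:ℝ)^ε ≤ (N:ℝ)^(2*ε) := Real.rpow_le_rpow_of_exponent_le hN1' (by linarith)
  have b2 : ‖(N:ℂ)^(1-s) / (s-1)‖ ≤ (N:ℝ)^(2*ε) := by
    rw [norm_div, Complex.norm_natCast_cpow_of_pos (by omega)]
    have : 1 ≤ ‖s - 1‖ := by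
      calc 1 ≤ |(s-1).im| := by simp; exact ht.trans (le_abs_self _)
        _ ≤ _ := Complex.abs_im_le_norm _
    apply (div_le_self (by positivity) this).trans
    refine le_trans ?_ hNe
    apply Real.rpow_le_rpow_of_exponent_le hN1'
    simp; linarith
  have b3 : ‖s * ∫ u in Set.Ioi (N:ℝ), ((u - (⌊u⌋₊ : ℝ) : ℝ) : ℂ) * (u : ℂ) ^ (-(s+1))‖ ≤ 8 * (N:ℝ)^(2*ε) := by
    have hNp : (0:ℝ) < N := by linarith
    have hi : IntegrableOn (fun u : ℝ => u ^ (-(s.re+1))) (Set.Ioi (N:ℝ)) :=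
      integrableOn_Ioi_rpow_of_lt (by linarith) hNp
    have : ‖∫ u in Set.Ioi (N:ℝ), ((u - (⌊u⌋₊ : ℝ) : ℝ) : ℂ) * (u : ℂ) ^ (-(s+1))‖ ≤
        ∫ u in Set.Ioi (N:ℝ), u ^ (-(s.re+1)) := by
      apply norm_integral_le_of_norm_le hi
      filter_upwards [self_mem_ae_restrict measurableSet_Ioi] with u hu
      have hu : (N:ℝ) < u := hu
      rw [norm_mul, Complex.norm_real, Real.norm_of_nonneg (fr_nonneg (by linarith)),
        Complex.norm_cpow_eq_rpow_re_of_pos (by linarith)]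
      simp only [neg_re, add_re, one_re]
      exact mul_le_of_le_one_left (Real.rpow_nonneg (by linarith) _) fr_le
    rw [integral_Ioi_rpow_of_lt (by linarith) hNp] at this
    have h5 : -(N:ℝ)^(-(s.re+1)+1) / (-(s.re+1)+1) ≤ 2 * ((N:ℝ)^ε / N) := by
      rw [show -(s.re+1)+1 = -s.re by ring, neg_div_neg_eq, div_le_iff₀ hσ]
      have : (N:ℝ)^(-s.re) ≤ (N:ℝ)^ε / N := by
        rw [← Real.rpow_sub_one hNp.ne']
        apply Real.rpow_le_rpow_of_exponent_le hN1'
        linarith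
      have h6 : 0 ≤ (N:ℝ)^ε / N := by positivity
      nlinarith
    have h7 : ‖s‖ ≤ 4 * N := by
      have := Complex.norm_le_abs_re_add_abs_im s
      rw [abs_of_pos hσ, abs_of_pos (by linarith : 0 < s.im)] at this
      have : ‖s‖ ≤ s.re + t := this
      linarith
    rw [norm_mul]
    calc _ ≤ (4 * N) * (2 * ((N:ℝ)^ε / N)) := by
          apply mul_le_mul h7 (this.trans h5) (norm_nonneg _) (by positivity)
      _ = 8 * (N:ℝ)^ε := by field_simp; norm_num
      _ ≤ _ := by gcongr
  have hfin : (N:ℝ)^(2*ε) ≤ 2 * t^(2*ε) := by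
    calc (N:ℝ)^(2*ε) ≤ (2*t)^(2*ε) := by gcongr
      _ = 2^(2*ε) * t^(2*ε) := Real.mul_rpow (by norm_num) (by linarith)
      _ ≤ 2^(1:ℝ) * t^(2*ε) := by
          gcongr
          · norm_num
          · linarith
      _ = _ := by norm_num
  calc _ ≤ C1 * (N:ℝ)^(2*ε) + (N:ℝ)^(2*ε) + 8 * (N:ℝ)^(2*ε) := 
        (norm_sub_le _ _).trans (add_le_add ((norm_add_le _ _).trans (add_le_add b1 b2)) b3)
    _ = (C1 + 9) * (N:ℝ)^(2*ε) := by ring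
    _ ≤ (C1 + 9) * (2 * t^(2*ε)) := by gcongr
    _ = _ := by ring

lemma zeta_bound {ε : ℝ} (h0 : 0 < ε) (h1 : ε ≤ 1/4) : ∃ C > 0, ∀ s : ℂ, 1 - ε ≤ s.re →
    s.re ≤ 3 → 1 ≤ |s.im| → ‖riemannZeta s‖ ≤ C * |s.im| ^ (2*ε) := by
  obtain ⟨C, hC, h⟩ := zeta_bound_pos h0 h1
  refine ⟨C, hC, fun s hs hs3 ht => ?_⟩
  rcases le_total 0 s.im with h2 | h2
  · rw [abs_of_nonneg h2] at ht ⊢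
    exact h s hs hs3 ht
  · rw [abs_of_nonpos h2] at ht ⊢
    have := h ((starRingEnd ℂ) s) (by simpa using hs) (by simpa using hs3) (by simpa using ht)
    rw [riemannZeta_conj, Complex.norm_conj] at this
    simpa using this

end

section
open Complex Set Filter Topology MeasureTheory Asymptotics

lemma zeta_deriv_bound {ε : ℝ} (h0 : 0 < ε) (h1 : ε ≤ 1/4) : ∃ C > 0, ∀ s : ℂ, 1 - ε/2 ≤ s.re →
    s.re ≤ 2 → 2 ≤ |s.im| → ‖deriv riemannZeta s‖ ≤ C * |s.im| ^ (2*ε) := by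
  obtain ⟨C, hC, h⟩ := zeta_bound h0 h1
  refine ⟨C * 2 / (ε/2), by positivity, fun s hs hs2 ht => ?_⟩
  have key : ∀ z, ‖z - s‖ ≤ ε/2 → 1 - ε ≤ z.re ∧ z.re ≤ 3 ∧ 1 ≤ |z.im| ∧ |z.im| ≤ 2 * |s.im| := by
    intro z hz
    have h3 := (Complex.abs_re_le_norm (z - s)).trans hz
    have h4 := (Complex.abs_im_le_norm (z - s)).trans hz
    simp only [sub_re, sub_im] at h3 h4
    have h5 := abs_le.1 h3
    have h6 : |s.im| - |z.im| ≤ ε/2 := (abs_sub_abs_le_abs_sub _ _).trans (by rwa [abs_sub_comm])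
    have h7 : |z.im| - |s.im| ≤ ε/2 := (abs_sub_abs_le_abs_sub _ _).trans h4
    refine ⟨by linarith, by linarith, by linarith, by linarith⟩
  have hd : DiffContOnCl ℂ riemannZeta (Metric.ball s (ε/2)) := by
    apply DifferentiableOn.diffContOnCl
    rw [closure_ball _ (by positivity)]
    intro z hz
    apply DifferentiableAt.differentiableWithinAt
    apply differentiableAt_riemannZeta
    rintro rfl
    have := key 1 (by simpa [dist_eq_norm] using hz)
    simp at this
    linarith [this.2]
  have := Complex.norm_deriv_le_of_forall_mem_sphere_norm_le (C := C * 2 * |s.im|^(2*ε)) 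
    (by positivity : 0 < ε/2) hd (by
      intro z hz
      obtain ⟨k1, k2, k3, k4⟩ := key z (by simpa [dist_eq_norm] using hz.le)
      refine (h z k1 k2 k3).trans ?_
      have : |z.im|^(2*ε) ≤ 2 * |s.im|^(2*ε) := by
        calc |z.im|^(2*ε) ≤ (2*|s.im|)^(2*ε) := by gcongr
          _ = 2^(2*ε) * |s.im|^(2*ε) := Real.mul_rpow (by norm_num) (by linarith)
          _ ≤ 2^(1:ℝ) * |s.im|^(2*ε) := by
              gcongr
              · norm_num
              · linarith
          _ = _ := by norm_num
      rw [mul_assoc]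
      gcongr)
  refine this.trans (le_of_eq ?_)
  ring

lemma zeta_near_one : ∃ M > 0, ∀ x : ℝ, 0 < x → x ≤ 1 → ‖riemannZeta (1 + x)‖ ≤ M / x := by
  have hc : IsCompact (Metric.closedBall (1:ℂ) 1) := isCompact_closedBall _ _
  obtain ⟨M, hM⟩ := hc.exists_bound_of_continuousOn (differentiable_riemannZeta₁.continuous.continuousOn)
  refine ⟨max M 1, by positivity, fun x hx hx1 => ?_⟩
  have hx' : (x:ℂ) ≠ 0 := by exact_mod_cast hx.ne'
  rw [riemannZeta_eq_inv_sub_mul (by simpa using hx'), norm_mul]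
  have := hM (1 + x) (by simp [abs_of_pos hx, hx1])
  simp only [add_sub_cancel_left, norm_inv, Complex.norm_real, Real.norm_of_nonneg hx.le]
  rw [div_eq_inv_mul]
  gcongr
  exact this.trans (le_max_left _ _)

lemma zeta_341 {x : ℝ} (hx : 0 < x) (y : ℝ) :
    1 ≤ ‖riemannZeta (1 + x)‖ ^ 3 * ‖riemannZeta (1 + x + I * y)‖ ^ 4 * ‖riemannZeta (1 + x + 2 * I * y)‖ := by
  have := DirichletCharacter.norm_LFunction_product_ge_one (1 : DirichletCharacter ℂ 1) hx y
  simpa [DirichletCharacter.LFunctionTrivChar, DirichletCharacter.LFunction_modOne_eq] using this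

lemma zeta_lower {η : ℝ} (h0 : 0 < η) (h1 : η ≤ 1) : ∃ c > 0, ∃ C > 0, c ≤ 1 ∧ ∀ s : ℂ, 2 ≤ |s.im| →
    1 - c * |s.im| ^ (-η) ≤ s.re → s.re ≤ 2 → riemannZeta s ≠ 0 ∧
      ‖deriv riemannZeta s‖ / ‖riemannZeta s‖ ≤ C * |s.im| ^ η := by
  set ε := η / 10 with hε
  have he : 0 < ε := by positivity
  obtain ⟨A, hA, hA'⟩ := zeta_bound he (by linarith)
  obtain ⟨B, hB, hB'⟩ := zeta_deriv_bound he (by linarith)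
  obtain ⟨M, hM, hM'⟩ := zeta_near_one
  set κ := 1 / (M^3 * A * 2) with hκ
  have hκ0 : 0 < κ := by positivity
  set c := min (κ / (256 * B^4)) (min (ε/2) (1/2)) with hc
  have hc0 : 0 < c := by positivity
  have hc1 : c ≤ κ / (256 * B^4) := min_le_left _ _
  have hc2 : c ≤ ε/2 := (min_le_right _ _).trans (min_le_left _ _)
  have hc3 : c ≤ 1/2 := (min_le_right _ _).trans (min_le_right _ _)
  refine ⟨c, hc0, 1 / (2*c), by positivity, by linarith, fun s ht hs hs2 => ?_⟩
  set t := s.im with htd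
  set τ := |t| ^ (2*ε) with hτ
  have ht0 : 0 < |t| := by linarith
  have hτ1 : 1 ≤ τ := Real.one_le_rpow (by linarith) (by linarith)
  have hτη : |t| ^ η = τ ^ 5 := by
    rw [hτ, ← Real.rpow_natCast, ← Real.rpow_mul ht0.le]; congr 1; rw [hε]; push_cast; ring
  have hτη' : |t| ^ (-η) = (τ ^ 5)⁻¹ := by rw [Real.rpow_neg ht0.le, hτη]
  rw [hτη'] at hs
  rw [hτη]
  set x := c * (τ^5)⁻¹ with hx
  have hx0 : 0 < x := by positivity
  have hxc : x ≤ c := mul_le_of_le_one_right hc0.le (inv_le_one_of_one_le₀ (one_le_pow₀ hτ1))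
  -- lower bound to the right
  have right : ∀ x' : ℝ, x ≤ x' → x' ≤ 1 → 4 * B * c * (τ^4)⁻¹ ≤ ‖riemannZeta (1 + x' + I * t)‖ := by
    intro x' hx1 hx2
    have hx'0 : 0 < x' := by linarith
    have h3 := zeta_341 hx'0 t
    have h4 := hM' x' hx'0 hx2
    have h5 := hA' (1 + x' + 2 * I * t) (by simp; linarith) (by simp; linarith) (by
      simp [abs_mul]; linarith)
    have h6 : |(1 + x' + 2 * I * t : ℂ).im| ^ (2*ε) ≤ 2 * τ := by
      simp only [add_im, one_im, ofReal_im, mul_im, mul_re]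
      simp [abs_mul]
      rw [Real.mul_rpow (by norm_num) ht0.le]
      gcongr
      calc (2:ℝ)^(2*ε) ≤ 2^(1:ℝ) := by
            apply Real.rpow_le_rpow_of_exponent_le (by norm_num); linarith
        _ = 2 := by norm_num
    set Z := ‖riemannZeta (1 + x' + I * t)‖ with hZ
    have h7 : 1 ≤ (M / x')^3 * Z^4 * (A * (2 * τ)) := by
      refine h3.trans ?_
      have h5' := h5.trans (mul_le_mul_of_nonneg_left h6 hA.le)
      gcongr
    have h8 : κ * x'^3 * τ⁻¹ ≤ Z^4 := by
      rw [hκ]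
      have : (M / x')^3 * Z^4 * (A * (2 * τ)) = Z^4 * ((M^3 * A * 2) * τ / x'^3) := by
        field_simp
      rw [this] at h7
      rw [← div_le_iff₀ (by positivity)] at h7
      refine le_trans (le_of_eq ?_) h7
      field_simp
    have h9 : κ * x^3 * τ⁻¹ ≤ Z^4 := le_trans (by gcongr) h8
    have h10 : (4 * B * c * (τ^4)⁻¹)^4 ≤ Z^4 := by
      refine le_trans ?_ h9
      have : c * (256 * B^4) ≤ κ := by rwa [le_div_iff₀ (by positivity)] at hc1
      calc (4 * B * c * (τ^4)⁻¹)^4 = (c * (256 * B^4)) * c^3 * (τ^16)⁻¹ := by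
            field_simp; ring
        _ ≤ κ * c^3 * (τ^16)⁻¹ := by gcongr
        _ = _ := by rw [hx]; field_simp
    exact le_of_pow_le_pow_left₀ (by norm_num) (norm_nonneg _) h10
  have lower : 2 * B * c * (τ^4)⁻¹ ≤ ‖riemannZeta s‖ := by
    rcases le_total (1 + x) s.re with h | h
    · have := right (s.re - 1) (by linarith) (by linarith)
      have e : (1 + ((s.re - 1 : ℝ) : ℂ) + I * t) = s := by
        apply Complex.ext <;> simp [htd]
      rw [e] at this
      refine le_trans ?_ this
      gcongr; norm_num
    · have h3 := right x le_rfl (by linarith)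
      set w : ℂ := 1 + x + I * t with hw
      have hwre : w.re = 1 + x := by simp [hw]
      have hwim : w.im = t := by simp [hw]
      have hcv : Convex ℝ ({z : ℂ | 1 - ε/2 ≤ z.re} ∩ {z : ℂ | z.re ≤ 2} ∩ {z : ℂ | z.im = t}) := by
        refine ((convex_halfSpace_re_ge _).inter (convex_halfSpace_re_le _)).inter ?_
        exact convex_hyperplane (IsLinearMap.mk Complex.add_im (fun c z => by simp)) t
      have h4 := Convex.norm_image_sub_le_of_norm_deriv_le (𝕜 := ℂ) (f := riemannZeta) (C := B * τ)
        (x := s) (y := w) (s := ({z : ℂ | 1 - ε/2 ≤ z.re} ∩ {z : ℂ | z.re ≤ 2} ∩ {z : ℂ | z.im = t})) (by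
          rintro z ⟨⟨_, _⟩, h3⟩
          apply differentiableAt_riemannZeta
          rintro rfl
          simp at h3
          rw [← h3] at ht0; simp at ht0) (by
          rintro z ⟨⟨z1, z2⟩, z3⟩
          have z3 : z.im = t := z3
          have := hB' z z1 z2 (by rw [z3]; exact ht)
          rwa [z3] at this) hcv ⟨⟨by simp; linarith, hs2⟩, rfl⟩ 
          ⟨⟨by simp only [mem_setOf_eq, hwre]; linarith, by simp only [mem_setOf_eq, hwre]; linarith⟩, hwim⟩
      have h5 : ‖w - s‖ ≤ 2 * x := by
        have e : w - s = ((1 + x - s.re : ℝ) : ℂ) := by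
          apply Complex.ext <;> simp [hwre, hwim, htd]
        rw [e, Complex.norm_real, Real.norm_of_nonneg (by linarith)]
        linarith
      have h6 : ‖riemannZeta w - riemannZeta s‖ ≤ 2 * B * c * (τ^4)⁻¹ := by
        refine h4.trans ((mul_le_mul_of_nonneg_left h5 (by positivity)).trans (le_of_eq ?_))
        rw [hx]; field_simp
      have h7 := norm_sub_norm_le (riemannZeta w) (riemannZeta s)
      have h8 : 4 * B * c * (τ^4)⁻¹ = 2 * (2 * B * c * (τ^4)⁻¹) := by ring
      linarith
  have hpos : 0 < 2 * B * c * (τ^4)⁻¹ := by positivity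
  refine ⟨norm_pos_iff.1 (hpos.trans_le lower), ?_⟩
  have hd := hB' s (by linarith) hs2 ht
  calc ‖deriv riemannZeta s‖ / ‖riemannZeta s‖ ≤ (B * τ) / (2 * B * c * (τ^4)⁻¹) := by gcongr
    _ = _ := by field_simp

end

section
open Complex Set Filter Topology MeasureTheory Asymptotics

noncomputable def GG (s : ℂ) : ℂ := - (deriv riemannZeta₁ s / riemannZeta₁ s) - riemannZeta₀ s

lemma GG_analytic {s : ℂ} (h : riemannZeta₁ s ≠ 0) : AnalyticAt ℂ GG s := by
  have h1 : AnalyticAt ℂ riemannZeta₁ s := differentiable_riemannZeta₁.analyticAt s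
  have h0 : AnalyticAt ℂ riemannZeta₀ s := differentiable_riemannZeta₀.analyticAt s
  exact ((h1.deriv.div h1 h).neg).sub h0

lemma zeta1_ne {s : ℂ} (h : s ≠ 1) (h' : riemannZeta s ≠ 0) : riemannZeta₁ s ≠ 0 := by
  intro h0; apply h'; rw [riemannZeta_eq_inv_sub_mul h, h0, mul_zero]

lemma zeta1_ne_re {s : ℂ} (h : 1 ≤ s.re) : riemannZeta₁ s ≠ 0 := by
  by_cases hs : s = 1
  · rw [hs]; simp
  · exact zeta1_ne hs (riemannZeta_ne_zero_of_one_le_re h)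

lemma GG_eq {s : ℂ} (h : s ≠ 1) (h' : riemannZeta s ≠ 0) :
    GG s = - (deriv riemannZeta s / riemannZeta s) - riemannZeta s := by
  have h1 := zeta1_ne h h'
  have h2 := sub_ne_zero.2 h
  unfold GG
  rw [deriv_riemannZeta_eq_neg_inv_sub_sq_mul_add h]
  have e1 := riemannZeta_eq_inv_sub_mul h
  have e0 := riemannZeta_eq_inv_sub_add h
  have : (-(s - 1)⁻¹ ^ 2 * riemannZeta₁ s + (s - 1)⁻¹ * deriv riemannZeta₁ s) / riemannZeta s
    = -(s-1)⁻¹ + deriv riemannZeta₁ s / riemannZeta₁ s := by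
    rw [e1]; field_simp
  rw [this, e0]; ring

lemma GG_growth (k : ℕ) : ∃ C > 0, ∀ s : ℂ, 1 < s.re → s.re ≤ 3/2 →
    ‖iteratedDeriv k GG s‖ ≤ C * (1 + |s.im|) ^ (1/2 : ℝ) := by
  set η : ℝ := 1 / (2 * (k+1)) with hη
  have hη0 : 0 < η := by positivity
  have hη1 : η ≤ 1/2 := by
    rw [hη]
    have : (0:ℝ) ≤ k := by positivity
    exact one_div_le_one_div_of_le (by norm_num) (by linarith)
  obtain ⟨c, hc, C, hC, hc1, H⟩ := zeta_lower hη0 (by linarith)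
  obtain ⟨A, hA, hA'⟩ := zeta_bound (ε := η/2) (by linarith) (by linarith)
  set q := min (c/2) (η/2) with hq
  have hq0 : 0 < q := by positivity
  have hqc : q ≤ c/2 := min_le_left _ _
  have hqη : q ≤ η/2 := min_le_right _ _
  set B1 := (k.factorial : ℝ) * (2*(C + A)) / q^k with hB1
  have hB1' : 0 < B1 := by positivity
  -- compact part
  have hcpt : IsCompact ((Icc (1:ℝ) (3/2)) ×ℂ (Icc (-3:ℝ) 3)) := isCompact_Icc.reProdIm isCompact_Icc
  have hcont : ContinuousOn (iteratedDeriv k GG) ((Icc (1:ℝ) (3/2)) ×ℂ (Icc (-3:ℝ) 3)) := by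
    intro s hs
    rw [mem_reProdIm] at hs
    have := (GG_analytic (zeta1_ne_re hs.1.1)).iterated_deriv k
    rw [← iteratedDeriv_eq_iterate] at this
    exact this.continuousAt.continuousWithinAt
  obtain ⟨B2, hB2⟩ := hcpt.exists_bound_of_continuousOn hcont
  refine ⟨max B1 B2, by positivity, fun s hs1 hs2 => ?_⟩
  by_cases ht : |s.im| ≤ 3
  · have h1 := hB2 s (by rw [mem_reProdIm]; exact ⟨⟨hs1.le, hs2⟩, abs_le.1 ht⟩)
    have : (1:ℝ) ≤ (1 + |s.im|) ^ (1/2 : ℝ) := Real.one_le_rpow (by linarith [abs_nonneg s.im]) (by norm_num)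
    calc _ ≤ B2 := h1
      _ ≤ max B1 B2 := le_max_right _ _
      _ ≤ _ := le_mul_of_one_le_right (by positivity) this
  push Not at ht
  set t := |s.im| with htd
  set r := q * t ^ (-η) with hr
  have ht0 : 0 < t := by linarith
  have htη : t ^ (-η) ≤ 1 := Real.rpow_le_one_of_one_le_of_nonpos (by linarith) (by linarith)
  have htη0 : 0 < t ^ (-η) := by positivity
  have hr0 : 0 < r := by positivity
  have hrη : r ≤ η/2 := by
    calc r ≤ q * 1 := by rw [hr]; gcongr
      _ ≤ _ := by linarith
  have key : ∀ z ∈ Metric.closedBall s r, riemannZeta z ≠ 0 ∧ z ≠ 1 ∧ ‖GG z‖ ≤ 2*(C + A) * t ^ η := by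
    intro z hz
    have hz' : ‖z - s‖ ≤ r := by simpa [dist_eq_norm] using hz
    have him : |z.im - s.im| ≤ r := by simpa using (abs_im_le_norm (z - s)).trans hz'
    have hre : |z.re - s.re| ≤ r := by simpa using (abs_re_le_norm (z - s)).trans hz'
    have i1 : |z.im| ≤ t + r := by
      have := abs_sub_abs_le_abs_sub z.im s.im; linarith
    have i2 : t - r ≤ |z.im| := by
      have := abs_sub_abs_le_abs_sub s.im z.im; rw [abs_sub_comm] at this; linarith
    have i3 : 2 ≤ |z.im| := by linarith
    have i4 : |z.im| ≤ 2 * t := by linarith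
    have hre' := abs_le.1 hre
    have i5 : t ^ (-η) / 2 ≤ |z.im| ^ (-η) := by
      calc t ^ (-η) / 2 = (2:ℝ) ^ (-1:ℝ) * t ^ (-η) := by rw [Real.rpow_neg_one]; ring
        _ ≤ (2:ℝ) ^ (-η) * t ^ (-η) := by
          gcongr
          · norm_num
          · linarith
        _ = (2*t) ^ (-η) := by rw [Real.mul_rpow (by norm_num) ht0.le]
        _ ≤ |z.im| ^ (-η) := Real.rpow_le_rpow_of_nonpos (by linarith) i4 (by linarith)
    have i6 : |z.im| ^ η ≤ 2 * t ^ η := by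
      calc |z.im| ^ η ≤ (2*t) ^ η := by gcongr
        _ = 2 ^ η * t ^ η := by rw [Real.mul_rpow (by norm_num) ht0.le]
        _ ≤ 2 ^ (1:ℝ) * t ^ η := by
          gcongr
          · norm_num
          · linarith
        _ = _ := by rw [Real.rpow_one]
    have hz1 : z ≠ 1 := by rintro rfl; simp at i3; linarith
    obtain ⟨hz0, hb⟩ := H z i3 (by
      have : r ≤ c * |z.im| ^ (-η) := by
        calc r ≤ c/2 * t ^ (-η) := by rw [hr]; gcongr
          _ = c * (t ^ (-η) / 2) := by ring
          _ ≤ _ := by gcongr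
      linarith [hre'.1]) (by linarith [hre'.2])
    have hb2 := hA' z (by linarith [hre'.1]) (by linarith [hre'.2]) (by linarith)
    rw [show 2 * (η/2) = η by ring] at hb2
    refine ⟨hz0, hz1, ?_⟩
    rw [GG_eq hz1 hz0]
    calc _ ≤ ‖deriv riemannZeta z‖ / ‖riemannZeta z‖ + ‖riemannZeta z‖ := by
          refine (norm_sub_le _ _).trans ?_
          rw [norm_neg, norm_div]
      _ ≤ C * |z.im| ^ η + A * |z.im| ^ η := by gcongr
      _ = (C + A) * |z.im| ^ η := by ring
      _ ≤ (C + A) * (2 * t ^ η) := by gcongr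
      _ = _ := by ring
  have hd : DifferentiableOn ℂ GG (Metric.closedBall s r) := fun z hz =>
    (GG_analytic (zeta1_ne (key z hz).2.1 (key z hz).1)).differentiableAt.differentiableWithinAt
  have := norm_iteratedDeriv_le_of_forall_mem_sphere_norm_le k hr0
    (DifferentiableOn.diffContOnCl_ball (U := Metric.closedBall s r) hd le_rfl) (C := 2*(C + A) * t ^ η)
    (fun z hz => (key z (Metric.sphere_subset_closedBall hz)).2.2)
  refine this.trans ?_
  have e : (k.factorial : ℝ) * (2*(C + A) * t ^ η) / r^k = B1 * t ^ (1/2:ℝ) := by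
    rw [hr, mul_pow, ← Real.rpow_natCast (t ^ (-η)), ← Real.rpow_mul ht0.le,
      show (1/2:ℝ) = η - (-η * k) by rw [hη]; field_simp; ring, Real.rpow_sub ht0, hB1]
    field_simp
  rw [e]
  gcongr
  · exact le_max_left _ _
  · linarith

end

section
open Complex Set Filter Topology MeasureTheory Asymptotics

noncomputable def phi (u : ℝ) : ℂ := ((max (1 - u) 0 : ℝ) : ℂ)

lemma phi_cont : Continuous phi := by unfold phi; fun_prop

lemma phi_eq {u : ℝ} (hu : u ∈ Ioi (0:ℝ)) : phi u = indicator (Ioc 0 1) (fun _ => 1 : ℝ → ℂ) u -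
    indicator (Ioc 0 1) (fun t => ↑t ^ (1:ℂ) : ℝ → ℂ) u := by
  unfold phi
  by_cases h : u ≤ 1
  · have hm : u ∈ Ioc (0:ℝ) 1 := ⟨hu, h⟩
    rw [indicator_of_mem hm, indicator_of_mem hm, max_eq_left (by linarith)]; simp
  · rw [indicator_of_notMem (fun h' => h h'.2), indicator_of_notMem (fun h' => h h'.2),
      max_eq_right (by linarith)]; simp

lemma phi_mellin {s : ℂ} (hs : 0 < s.re) : HasMellin phi s (1 / (s * (s+1))) := by
  have h1 := hasMellin_one_Ioc hs
  have h2 := hasMellin_cpow_Ioc (1:ℂ) (s := s) (by simp; linarith)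
  have h3 := hasMellin_sub h1.1 h2.1
  have hs0 : s ≠ 0 := by rintro rfl; simp at hs
  have hs1 : s + 1 ≠ 0 := by
    intro h; have := congrArg re h; simp at this; linarith
  constructor
  · refine (integrableOn_congr_fun (fun t ht => ?_) measurableSet_Ioi).2 h3.1
    simp only [phi_eq ht]
  · have : mellin phi s = _ := setIntegral_congr_fun measurableSet_Ioi (g := fun t : ℝ => (t:ℂ) ^ (s-1) • (indicator (Ioc 0 1) (fun _ => 1 : ℝ → ℂ) t -
    indicator (Ioc 0 1) (fun t => ↑t ^ (1:ℂ) : ℝ → ℂ) t)) (fun t ht => by simp only [phi_eq ht])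
    rw [this]
    have h4 := h3.2
    rw [mellin] at h4
    rw [h4, h1.2, h2.2]
    field_simp; ring

lemma kern_norm {σ : ℝ} (hσ : 1 ≤ σ) (y : ℝ) : ‖1 / (((σ:ℂ) + y * I) * ((σ:ℂ) + y*I + 1))‖ ≤ 4 * (1 + |y|) ^ (-2:ℝ) := by
  have h1 : (1 + |y|)/2 ≤ ‖(σ:ℂ) + y * I‖ := by
    have a := abs_re_le_norm ((σ:ℂ) + y * I)
    have b := abs_im_le_norm ((σ:ℂ) + y * I)
    simp at a b
    linarith [le_abs_self σ]
  have h2 : (1 + |y|)/2 ≤ ‖(σ:ℂ) + y * I + 1‖ := by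
    have a := abs_re_le_norm ((σ:ℂ) + y * I + 1)
    have b := abs_im_le_norm ((σ:ℂ) + y * I + 1)
    simp at a b
    linarith [le_abs_self (σ+1)]
  have hy : 0 < 1 + |y| := by positivity
  rw [norm_div, norm_mul, norm_one]
  calc _ ≤ 1 / ((1 + |y|)/2 * ((1+|y|)/2)) := by gcongr
    _ = _ := by
      rw [Real.rpow_neg hy.le, show (2:ℝ) = ((2:ℕ):ℝ) by norm_num, Real.rpow_natCast]
      push_cast; field_simp; norm_num

lemma kern_cont {σ : ℝ} (hσ : 1 ≤ σ) : Continuous (fun y : ℝ => 1 / (((σ:ℂ) + y * I) * ((σ:ℂ) + y*I + 1))) := by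
  refine Continuous.div continuous_const (by fun_prop) (fun y h => ?_)
  rcases mul_eq_zero.1 h with h | h <;> have := congrArg re h <;> simp at this <;> linarith

lemma int_pow {a : ℝ} (ha : 1 < a) : Integrable (fun y : ℝ => (1 + |y|) ^ (-a)) := by
  have := integrable_one_add_norm (E := ℝ) (μ := volume) (r := a) (by simpa using ha)
  simpa using this

lemma kern_int {σ : ℝ} (hσ : 1 ≤ σ) : Integrable (fun y : ℝ => 1 / (((σ:ℂ) + y * I) * ((σ:ℂ) + y*I + 1))) :=
  ((int_pow (a := 2) (by norm_num)).const_mul 4).mono' (kern_cont hσ).aestronglyMeasurable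
    (Eventually.of_forall (kern_norm hσ))

lemma perron {σ : ℝ} (hσ : 1 ≤ σ) {u : ℝ} (hu : 0 < u) :
    phi u = (1 / (2 * Real.pi) : ℝ) • ∫ y : ℝ, (u:ℂ) ^ (-((σ:ℂ) + y * I)) • (1 / (((σ:ℂ) + y * I) * ((σ:ℂ) + y*I + 1))) := by
  have hm : ∀ y : ℝ, mellin phi (σ + y * I) = 1 / (((σ:ℂ) + y * I) * ((σ:ℂ) + y*I + 1)) := fun y =>
    (phi_mellin (by simp; linarith)).2
  rw [← mellinInv_mellin_eq σ phi hu (phi_mellin (by simp; linarith)).1 ?_ phi_cont.continuousAt]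
  · rw [mellinInv]
    simp only [hm]
  · unfold VerticalIntegrable
    simp only [hm]
    exact kern_int hσ

lemma smooth_bound : ∃ K > 0, ∀ (b : ℕ → ℂ) (F : ℂ → ℂ) (C σ x : ℝ), b 0 = 0 → 1 ≤ σ → 0 < x → 0 ≤ C →
    (LSeriesSummable b σ) → (∀ y : ℝ, LSeries b (σ + y * I) = F (σ + y * I)) →
    (∀ y : ℝ, ‖F (σ + y * I)‖ ≤ C * (1 + |y|) ^ (1/2:ℝ)) →
    ‖∑ n ∈ Finset.Icc 1 ⌊x⌋₊, b n * (1 - n / x)‖ ≤ K * C * x ^ σ := by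
  set J := ∫ y : ℝ, (1 + |y|) ^ (-(3/2:ℝ)) with hJ
  have hJ0 : 0 ≤ J := integral_nonneg (fun y => by positivity)
  refine ⟨4 * J + 1, by positivity, fun b F C σ x hb hσ hx hC hsum hF hFb => ?_⟩
  set k : ℝ → ℂ := fun y => 1 / (((σ:ℂ) + y * I) * ((σ:ℂ) + y*I + 1)) with hk
  set T : ℕ → ℝ → ℂ := fun n y => LSeries.term b (σ + y * I) n * ((x:ℂ) ^ ((σ:ℂ) + y * I) * k y) with hT
  have hx0 : (x:ℂ) ≠ 0 := by exact_mod_cast hx.ne'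
  have hterm : ∀ n (y : ℝ), ‖LSeries.term b (σ + y * I) n‖ = ‖LSeries.term b σ n‖ := by
    intro n y; rw [LSeries.norm_term_eq, LSeries.norm_term_eq]; simp
  have hxn : ∀ y : ℝ, ‖(x:ℂ) ^ ((σ:ℂ) + y * I)‖ = x ^ σ := by
    intro y; rw [norm_cpow_eq_rpow_re_of_pos hx]; simp
  have hcpow : ∀ z : ℂ, z ≠ 0 → Continuous (fun y : ℝ => z ^ ((σ:ℂ) + y * I)) := by
    intro z hz
    exact Continuous.const_cpow (by fun_prop) (Or.inl hz)
  have hTn : ∀ n y, ‖T n y‖ = ‖LSeries.term b σ n‖ * x ^ σ * ‖k y‖ := by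
    intro n y; simp only [hT, norm_mul, hterm, hxn]; ring
  have hTi : ∀ n, Integrable (T n) := by
    intro n
    refine ((kern_int hσ).norm.const_mul (‖LSeries.term b σ n‖ * x ^ σ)).mono' ?_ (Eventually.of_forall fun y => (hTn n y).le)
    apply Continuous.aestronglyMeasurable
    refine Continuous.mul ?_ ((hcpow _ hx0).mul (kern_cont hσ))
    rcases Nat.eq_zero_or_pos n with rfl | hn
    · simpa using continuous_const
    · have : (n:ℂ) ≠ 0 := by exact_mod_cast hn.ne'
      simp only [LSeries.term_of_ne_zero hn.ne']
      exact continuous_const.div (hcpow _ this) (fun y => by simp [cpow_eq_zero_iff, this])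
  have hTs : Summable (fun n => ∫ y, ‖T n y‖) := by
    simp_rw [hTn, integral_const_mul]
    exact (hsum.norm.mul_right _).mul_right _
  have h1 := integral_tsum_of_summable_integral_norm hTi hTs
  have hphi : ∀ n : ℕ, ∫ y, T n y = (2 * Real.pi) * (b n * phi (n / x)) := by
    intro n
    rcases Nat.eq_zero_or_pos n with rfl | hn
    · simp [hT, hb]
    have hn0 : (n:ℂ) ≠ 0 := by exact_mod_cast hn.ne'
    rw [perron hσ (u := n / x) (by positivity)]
    have : ∀ y : ℝ, T n y = b n * ((((n / x:ℝ)):ℂ) ^ (-((σ:ℂ) + y * I)) • (1 / (((σ:ℂ) + y * I) * ((σ:ℂ) + y*I + 1)))) := by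
      intro y
      simp only [hT, hk, LSeries.term_of_ne_zero hn.ne', smul_eq_mul]
      have e : (n:ℂ) ^ ((σ:ℂ) + y * I) = (x:ℂ) ^ ((σ:ℂ) + y * I) * ((n / x:ℝ):ℂ) ^ ((σ:ℂ) + y * I) := by
        rw [← mul_cpow_ofReal_nonneg hx.le (by positivity)]
        congr 1; push_cast; field_simp
      have e2 : ((n / x:ℝ):ℂ) ^ ((σ:ℂ) + y * I) ≠ 0 := by
        have : ((n / x:ℝ):ℂ) ≠ 0 := by push_cast; positivity
        exact fun h => this ((cpow_eq_zero_iff _ _).1 h).1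
      rw [e, cpow_neg]
      have : (x:ℂ) ^ ((σ:ℂ) + y * I) ≠ 0 := by simp [cpow_eq_zero_iff, hx0]
      field_simp
    simp_rw [this, integral_const_mul, real_smul]
    generalize (∫ (a : ℝ), (((n / x:ℝ)):ℂ) ^ (-((σ:ℂ) + a * I)) • (1 / (((σ:ℂ) + a * I) * ((σ:ℂ) + a*I + 1)))) = Q
    push_cast
    have : (Real.pi:ℂ) ≠ 0 := by exact_mod_cast Real.pi_ne_zero
    field_simp
  have h2 : ∀ y, ∑' n, T n y = F (σ + y * I) * ((x:ℂ) ^ ((σ:ℂ) + y * I) * k y) := by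
    intro y; rw [← hF, LSeries, tsum_mul_right]
  simp_rw [hphi, h2, tsum_mul_left] at h1
  have h3 : ∑' n : ℕ, b n * phi (n / x) = ∑ n ∈ Finset.Icc 1 ⌊x⌋₊, b n * (1 - n / x) := by
    rw [tsum_eq_sum (s := Finset.Icc 1 ⌊x⌋₊)]
    · refine Finset.sum_congr rfl fun n hn => ?_
      have : (n:ℝ) ≤ x := (Nat.le_floor_iff hx.le).1 (Finset.mem_Icc.1 hn).2
      unfold phi
      rw [max_eq_left (by rw [sub_nonneg]; exact (div_le_one hx).2 this)]; push_cast; rfl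
    · intro n hn
      rcases Nat.eq_zero_or_pos n with rfl | hn0
      · simp [hb]
      have : x ≤ n := by
        by_contra h
        exact hn (Finset.mem_Icc.2 ⟨hn0, Nat.le_floor (not_le.1 h).le⟩)
      unfold phi
      rw [max_eq_right (by rw [sub_nonpos]; exact (one_le_div hx).2 this)]; simp
  rw [h3] at h1
  have h4 : ‖∫ y : ℝ, F (σ + y * I) * ((x:ℂ) ^ ((σ:ℂ) + y * I) * k y)‖ ≤ ∫ y : ℝ, (4 * C * x ^ σ) * (1 + |y|) ^ (-(3/2:ℝ)) := by
    refine norm_integral_le_of_norm_le ((int_pow (by norm_num)).const_mul _) (Eventually.of_forall fun y => ?_)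
    have hy : 0 < 1 + |y| := by positivity
    rw [norm_mul, norm_mul, hxn]
    calc _ ≤ (C * (1 + |y|) ^ (1/2:ℝ)) * (x ^ σ * (4 * (1 + |y|) ^ (-2:ℝ))) := by
          gcongr
          · exact hFb y
          · exact kern_norm hσ y
      _ = 4 * C * x ^ σ * ((1 + |y|) ^ (1/2:ℝ) * (1 + |y|) ^ (-2:ℝ)) := by ring
      _ = _ := by rw [← Real.rpow_add hy]; norm_num
  rw [integral_const_mul, ← hJ, ← h1, norm_mul] at h4
  have h5 : (1:ℝ) ≤ ‖(2 * Real.pi : ℂ)‖ := by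
    rw [norm_mul, norm_real]; simp [abs_of_pos Real.pi_pos]; linarith [Real.pi_gt_three]
  have hxs : 0 ≤ x ^ σ := by positivity
  calc _ ≤ ‖(2 * Real.pi : ℂ)‖ * ‖∑ n ∈ Finset.Icc 1 ⌊x⌋₊, b n * (1 - n / x)‖ := le_mul_of_one_le_left (norm_nonneg _) h5
    _ ≤ _ := h4
    _ ≤ _ := by nlinarith [mul_nonneg hC hxs]

end

section
open Complex Set Filter Topology MeasureTheory Asymptotics
open scoped ArithmeticFunction.vonMangoldt

lemma logMul_iter (f : ℕ → ℂ) (k n : ℕ) : (LSeries.logMul^[k] f) n = (Complex.log n) ^ k * f n := by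
  induction k generalizing f with
  | zero => simp
  | succ k ih => rw [Function.iterate_succ_apply, ih, LSeries.logMul]; ring

lemma lam_sub_one {s : ℂ} (hs : 1 < s.re) : LSeriesSummable (fun n => (Λ n : ℂ) - 1) s ∧
    LSeries (fun n => (Λ n : ℂ) - 1) s = GG s := by
  have h1 := ArithmeticFunction.LSeriesSummable_vonMangoldt hs
  have h2 : LSeriesSummable 1 s := LSeriesSummable_one_iff.2 hs
  refine ⟨h1.sub h2, ?_⟩
  have := LSeries_sub h1 h2
  rw [ArithmeticFunction.LSeries_vonMangoldt_eq_deriv_riemannZeta_div hs, LSeries_one_eq_riemannZeta hs] at this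
  rw [GG_eq (by rintro rfl; simp at hs) (riemannZeta_ne_zero_of_one_le_re hs.le), ← neg_div, ← this]
  rfl

lemma W_bound {k : ℕ} (hk : 1 ≤ k) : ∃ C > 0, ∀ x : ℝ, 2 ≤ Real.log x → 0 < x →
    |∑ n ∈ Finset.Icc 1 ⌊x⌋₊, (Λ n - 1) * (Real.log n) ^ k * (x - n)| ≤ C * x ^ 2 := by
  obtain ⟨C, hC, hG⟩ := GG_growth k
  obtain ⟨K, hK, H⟩ := smooth_bound
  refine ⟨K * C * Real.exp 1, by positivity, fun x hl hx => ?_⟩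
  set σ := 1 + 1 / Real.log x with hσ
  have hi : 0 < 1 / Real.log x := by positivity
  have hi2 : 1 / Real.log x ≤ 1/2 := one_div_le_one_div_of_le (by norm_num) hl
  have hab : LSeries.abscissaOfAbsConv (fun n => (Λ n : ℂ) - 1) ≤ 1 :=
    LSeries.abscissaOfAbsConv_le_of_forall_lt_LSeriesSummable' (fun y hy => (lam_sub_one (s := y) (by
      rw [ofReal_re]; exact_mod_cast hy)).1)
  have hab' : ∀ s : ℂ, 1 < s.re → LSeries.abscissaOfAbsConv (fun n => (Λ n : ℂ) - 1) < s.re := fun s hs =>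
    lt_of_le_of_lt hab (by exact_mod_cast hs)
  have hev : ∀ s : ℂ, 1 < s.re → LSeries (fun n => (Λ n : ℂ) - 1) =ᶠ[𝓝 s] GG := by
    intro s hs
    filter_upwards [(isOpen_lt continuous_const continuous_re).mem_nhds hs] with z hz
    exact (lam_sub_one hz).2
  set b : ℕ → ℂ := (LSeries.logMul^[k] (fun n => (Λ n : ℂ) - 1)) with hb
  have := H b (LSeries b) C σ x (by rw [hb, logMul_iter]; simp; omega) (by linarith) hx hC.le (by
    apply LSeriesSummable_of_abscissaOfAbsConv_lt_re
    rw [hb, LSeries.absicssaOfAbsConv_logPowMul]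
    apply hab'; simp; linarith) (fun y => rfl) (by
    intro y
    have hs : 1 < ((σ:ℂ) + y * I).re := by simp; linarith
    have h1 := LSeries_iteratedDeriv k (hab' _ hs)
    rw [(hev _ hs).iteratedDeriv_eq] at h1
    have h2 := hG _ hs (by simp; linarith)
    rw [h1, norm_mul] at h2
    simpa using h2)
  have e : (∑ n ∈ Finset.Icc 1 ⌊x⌋₊, b n * (1 - n / x)) * x = ((∑ n ∈ Finset.Icc 1 ⌊x⌋₊, (Λ n - 1) * (Real.log n) ^ k * (x - n) : ℝ) : ℂ) := by
    push_cast
    rw [Finset.sum_mul]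
    refine Finset.sum_congr rfl fun n hn => ?_
    have hx' : (x:ℂ) ≠ 0 := by exact_mod_cast hx.ne'
    rw [hb, logMul_iter]
    field_simp
  have e2 : x ^ σ = x * Real.exp 1 := by
    rw [hσ, Real.rpow_add hx, Real.rpow_one, Real.rpow_def_of_pos hx]
    congr 2; field_simp
  rw [← Real.norm_eq_abs, ← norm_real, ← e, norm_mul, norm_real, Real.norm_of_nonneg hx.le]
  rw [e2] at this
  calc _ ≤ K * C * (x * Real.exp 1) * x := by gcongr
    _ = _ := by ring

end

section
open Complex Set Filter Topology MeasureTheory Asymptotics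
open scoped ArithmeticFunction.vonMangoldt

noncomputable def SS (a : ℕ → ℝ) (x : ℝ) : ℝ := ∑ n ∈ Finset.Icc 0 ⌊x⌋₊, a n
noncomputable def WW (a : ℕ → ℝ) (x : ℝ) : ℝ := ∑ n ∈ Finset.Icc 0 ⌊x⌋₊, a n * (x - n)

lemma Icc_zero_eq {M : Type*} [AddCommMonoid M] (a : ℕ → M) (h : a 0 = 0) (m : ℕ) : ∑ n ∈ Finset.Icc 0 m, a n = ∑ n ∈ Finset.Icc 1 m, a n := by
  symm
  apply Finset.sum_subset
  · intro n hn; simp at hn ⊢; omega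
  · intro n hn hn'
    have : n = 0 := by simp at hn hn'; omega
    rw [this, h]

lemma unsm {p : ℕ → ℝ} (hp : ∀ n, 0 ≤ p n) {x δ : ℝ} (hx : 0 ≤ x) (hδ : 0 ≤ δ) :
    δ * SS p x ≤ WW p (x + δ) - WW p x ∧ WW p (x + δ) - WW p x ≤ δ * SS p (x + δ) := by
  have hsub : Finset.Icc 0 ⌊x⌋₊ ⊆ Finset.Icc 0 ⌊x + δ⌋₊ :=
    Finset.Icc_subset_Icc_right (Nat.floor_le_floor (by linarith))
  constructor
  · have h1 : ∑ n ∈ Finset.Icc 0 ⌊x⌋₊, p n * (x + δ - n) ≤ WW p (x + δ) := by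
      apply Finset.sum_le_sum_of_subset_of_nonneg hsub
      intro n hn _
      have : (n:ℝ) ≤ x + δ := (Nat.le_floor_iff (by linarith)).1 (Finset.mem_Icc.1 hn).2
      exact mul_nonneg (hp n) (by linarith)
    have h2 : ∑ n ∈ Finset.Icc 0 ⌊x⌋₊, p n * (x + δ - n) = WW p x + δ * SS p x := by
      rw [WW, SS, Finset.mul_sum, ← Finset.sum_add_distrib]
      exact Finset.sum_congr rfl fun n _ => by ring
    linarith
  · have h1 : ∑ n ∈ Finset.Icc 0 ⌊x + δ⌋₊, p n * (x - n) ≤ WW p x := by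
      rw [WW, ← Finset.sum_sdiff hsub]
      have : ∑ n ∈ Finset.Icc 0 ⌊x + δ⌋₊ \ Finset.Icc 0 ⌊x⌋₊, p n * (x - n) ≤ 0 := by
        apply Finset.sum_nonpos
        intro n hn
        have : x < n := by
          simp at hn
          exact (Nat.floor_lt hx).1 hn.2
        exact mul_nonpos_of_nonneg_of_nonpos (hp n) (by linarith)
      linarith
    have h2 : ∑ n ∈ Finset.Icc 0 ⌊x + δ⌋₊, p n * (x - n) = WW p (x + δ) - δ * SS p (x + δ) := by
      rw [WW, SS, Finset.mul_sum, ← Finset.sum_sub_distrib]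
      exact Finset.sum_congr rfl fun n _ => by ring
    linarith

lemma SS_log_short {k : ℕ} {x δ : ℝ} (hx : 1 ≤ x) (hδ : 0 ≤ δ) :
    SS (fun n => Real.log n ^ k) (x + δ) ≤ SS (fun n => Real.log n ^ k) x + (δ + 1) * Real.log (x + δ) ^ k := by
  have hsub : Finset.Icc 0 ⌊x⌋₊ ⊆ Finset.Icc 0 ⌊x + δ⌋₊ :=
    Finset.Icc_subset_Icc_right (Nat.floor_le_floor (by linarith))
  unfold SS
  rw [← Finset.sum_sdiff hsub]
  have h1 : ∀ n ∈ Finset.Icc 0 ⌊x + δ⌋₊ \ Finset.Icc 0 ⌊x⌋₊, Real.log n ^ k ≤ Real.log (x + δ) ^ k := by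
    intro n hn
    simp only [Finset.mem_sdiff, Finset.mem_Icc, zero_le, true_and, not_le] at hn
    have h1 : x < n := (Nat.floor_lt (by linarith)).1 hn.2
    have h2 : (n:ℝ) ≤ x + δ := (Nat.le_floor_iff (by linarith)).1 hn.1
    have := Real.log_nonneg (x := n) (by linarith)
    have h3 : Real.log n ≤ Real.log (x + δ) := Real.log_le_log (by linarith) h2
    gcongr
  have h2 := Finset.sum_le_card_nsmul _ _ _ h1
  have h3 : ((Finset.Icc 0 ⌊x + δ⌋₊ \ Finset.Icc 0 ⌊x⌋₊).card : ℝ) ≤ δ + 1 := by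
    rw [Finset.card_sdiff_of_subset hsub]
    simp only [Nat.card_Icc, tsub_zero]
    have a := Nat.floor_le (show 0 ≤ x + δ by linarith)
    have b := Nat.lt_floor_add_one x
    have c : ⌊x⌋₊ ≤ ⌊x + δ⌋₊ := (Nat.floor_le_floor (by linarith))
    rw [Nat.cast_sub (by omega)]
    push_cast; linarith
  have h4 : 0 ≤ Real.log (x + δ) ^ k := pow_nonneg (Real.log_nonneg (by linarith)) _
  rw [nsmul_eq_mul] at h2
  nlinarith

lemma psi_large {m : ℕ} (hm : 1 ≤ m) : ∃ C > 0, ∃ X : ℝ, ∀ x ≥ X,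
    |SS (fun n => (Λ n - 1) * Real.log n ^ (2*m)) x| ≤ C * x * Real.log x ^ m := by
  obtain ⟨C, hC, hW⟩ := W_bound (k := 2*m) (by omega)
  set p : ℕ → ℝ := fun n => Λ n * Real.log n ^ (2*m) with hp
  set q : ℕ → ℝ := fun n => Real.log n ^ (2*m) with hq
  have hp0 : ∀ n, 0 ≤ p n := fun n => mul_nonneg ArithmeticFunction.vonMangoldt_nonneg (pow_nonneg (Real.log_natCast_nonneg n) _)
  have hq0 : ∀ n, 0 ≤ q n := fun n => (pow_nonneg (Real.log_natCast_nonneg n) _)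
  have hW' : ∀ x : ℝ, 2 ≤ Real.log x → 0 < x → |WW p x - WW q x| ≤ C * x ^ 2 := by
    intro x h1 h2
    have := hW x h1 h2
    rw [← Icc_zero_eq (fun n : ℕ => (Λ n - 1) * (Real.log n) ^ (2*m) * (x - n)) (by simp; omega)] at this
    convert this using 2
    rw [WW, WW, ← Finset.sum_sub_distrib]
    exact Finset.sum_congr rfl fun n _ => by simp only [hp, hq]; ring
  have hev : ∀ᶠ x : ℝ in atTop, Real.log x ^ m ≤ x := by
    have := (isLittleO_log_rpow_rpow_atTop (s := 1) m (by norm_num)).bound (c := 1) (by norm_num)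
    filter_upwards [this, eventually_ge_atTop 1] with x hx hx1
    simp at hx
    rw [abs_of_nonneg (Real.log_nonneg hx1), abs_of_nonneg (by linarith : (0:ℝ) ≤ x)] at hx
    exact hx
  obtain ⟨X, hX⟩ := (hev.and (eventually_ge_atTop (Real.exp 3))).exists_forall_of_atTop
  refine ⟨8 * C + 2 * 4 ^ m, by positivity, X, fun x hx => ?_⟩
  obtain ⟨hx1, hx2⟩ := hX x hx
  have hx0 : 0 < x := (Real.exp_pos 3).trans_le hx2
  have hl : 3 ≤ Real.log x := (Real.le_log_iff_exp_le hx0).2 hx2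
  set l := Real.log x with hld
  have hlm : 0 < l ^ m := by positivity
  set δ := x / l ^ m with hδ
  have hlm2 : 2 ≤ l ^ m := by
    calc (2:ℝ) ≤ l ^ 1 := by linarith
      _ ≤ l ^ m := pow_le_pow_right₀ (by linarith) hm
  have hδ1 : 1 ≤ δ := by rw [hδ, le_div_iff₀ hlm]; linarith
  have hδ2 : δ ≤ x / 2 := by rw [hδ]; gcongr
  have hlog2 : Real.log 2 ≤ 1 := by linarith [Real.log_two_lt_d9]
  have hl1 : Real.log (x + δ) ≤ 2 * l := by
    calc Real.log (x + δ) ≤ Real.log (2 * x) := Real.log_le_log (by linarith) (by linarith)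
      _ = Real.log 2 + l := Real.log_mul (by norm_num) hx0.ne'
      _ ≤ _ := by linarith
  have hl2 : 2 ≤ Real.log (x - δ) := by
    have : Real.log (x / 2) ≤ Real.log (x - δ) := Real.log_le_log (by linarith) (by linarith)
    rw [Real.log_div hx0.ne' (by norm_num)] at this
    linarith
  have hl3 : l ≤ Real.log (x + δ) := Real.log_le_log hx0 (by linarith)
  have e1 : (δ + 1) * Real.log (x + δ) ^ (2*m) ≤ 2 * 4 ^ m * x * l ^ m := by
    calc (δ + 1) * Real.log (x + δ) ^ (2*m) ≤ (2 * δ) * (2 * l) ^ (2 * m) := by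
          have : 0 ≤ Real.log (x + δ) := by linarith
          gcongr; linarith
      _ = _ := by rw [hδ, mul_pow, pow_mul, mul_comm 2 m, pow_mul]; norm_num; field_simp
  have e2 : (δ + 1) * Real.log x ^ (2*m) ≤ 2 * 4 ^ m * x * l ^ m := by
    refine le_trans ?_ e1
    gcongr
  have eS : SS (fun n => (Λ n - 1) * Real.log n ^ (2*m)) x = SS p x - SS q x := by
    rw [SS, SS, SS, ← Finset.sum_sub_distrib]
    exact Finset.sum_congr rfl fun n _ => by simp only [hp, hq]; ring
  have hxδ : 8 * C * x * l ^ m * δ = 8 * C * x ^ 2 := by rw [hδ]; field_simp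
  have hδ0 : 0 < δ := by linarith
  have a1 := abs_le.1 (hW' (x + δ) (by linarith) (by linarith))
  have a2 := abs_le.1 (hW' x (by linarith) (by linarith))
  have a3 := abs_le.1 (hW' (x - δ) (by linarith) (by linarith))
  have b1 := unsm hp0 hx0.le hδ0.le
  have b2 := unsm hq0 hx0.le hδ0.le
  have b3 := unsm hp0 (show 0 ≤ x - δ by linarith) hδ0.le
  have b4 := unsm hq0 (show 0 ≤ x - δ by linarith) hδ0.le
  have c1 := SS_log_short (k := 2*m) (show 1 ≤ x by linarith) hδ0.le
  have c2 := SS_log_short (k := 2*m) (show 1 ≤ x - δ by linarith) hδ0.le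
  rw [sub_add_cancel] at b3 b4 c2
  rw [← hq] at c1 c2
  have s1 : C * (x + δ)^2 ≤ 4 * C * x ^ 2 := by
    have : (x + δ)^2 ≤ (2 * x)^2 := by gcongr; linarith
    nlinarith
  have s2 : C * (x - δ)^2 ≤ C * x ^ 2 := by
    have : (x - δ)^2 ≤ x ^2 := by gcongr <;> linarith
    nlinarith
  have s3 : 0 ≤ C * x ^ 2 := by positivity
  have e5 : δ * ((8 * C + 2 * 4 ^ m) * x * l ^ m) = 8 * C * x ^ 2 + δ * (2 * 4 ^ m * x * l ^ m) := by
    rw [← hxδ]; ring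
  rw [eS, abs_le]
  constructor
  · apply le_of_mul_le_mul_left _ hδ0
    have : δ * SS q x ≤ δ * SS q (x - δ) + δ * (2 * 4 ^ m * x * l ^ m) := by
      rw [← mul_add]; exact mul_le_mul_of_nonneg_left (by linarith) hδ0.le
    rw [mul_neg, e5, mul_sub]
    linarith [b3.2, b4.1]
  · apply le_of_mul_le_mul_left _ hδ0
    have : δ * SS q (x + δ) ≤ δ * SS q x + δ * (2 * 4 ^ m * x * l ^ m) := by
      rw [← mul_add]; exact mul_le_mul_of_nonneg_left (by linarith) hδ0.le
    rw [e5, mul_sub]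
    linarith [b1.1, b2.2]

lemma psi_bound {m : ℕ} (hm : 1 ≤ m) : ∃ C > 0, ∀ x ≥ 2,
    |SS (fun n => (Λ n - 1) * Real.log n ^ (2*m)) x| ≤ C * x * Real.log x ^ m := by
  obtain ⟨C, hC, X, H⟩ := psi_large hm
  set M := ∑ n ∈ Finset.Icc 0 ⌊X⌋₊, |(Λ n - 1) * Real.log n ^ (2*m)| with hM
  have hM0 : 0 ≤ M := Finset.sum_nonneg fun _ _ => abs_nonneg _
  have hl2 : 0 < Real.log 2 := Real.log_pos (by norm_num)
  refine ⟨C + M / (2 * Real.log 2 ^ m), by positivity, fun x hx => ?_⟩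
  have hl : Real.log 2 ≤ Real.log x := Real.log_le_log (by norm_num) hx
  have hlx : 0 ≤ Real.log x := by linarith
  rcases le_total X x with h | h
  · refine (H x h).trans ?_
    gcongr
    have : 0 ≤ M / (2 * Real.log 2 ^ m) := by positivity
    linarith
  · calc _ ≤ M := by
          refine (Finset.abs_sum_le_sum_abs _ _).trans ?_
          exact Finset.sum_le_sum_of_subset_of_nonneg (Finset.Icc_subset_Icc_right (Nat.floor_le_floor h)) (fun _ _ _ => abs_nonneg _)
      _ = M / (2 * Real.log 2 ^ m) * 2 * Real.log 2 ^ m := by field_simp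
      _ ≤ _ := by gcongr; linarith

end

section
open Complex Set Filter Topology MeasureTheory Asymptotics
open scoped ArithmeticFunction.vonMangoldt

lemma log_two_pos' : 0 < Real.log 2 := Real.log_pos (by norm_num)
lemma log_pos2 {x : ℝ} (hx : 2 ≤ x) : 0 < Real.log x := Real.log_pos (by linarith)

lemma quasi_mono (A : ℕ) : ∃ C > 0, ∀ u x : ℝ, 2 ≤ u → u ≤ x →
    1 / Real.log u ^ A ≤ C * x ^ (1/2:ℝ) / Real.log x ^ A * u ^ (-(1/2:ℝ)) := by
  refine ⟨(2 / Real.log 2) ^ A * A.factorial * Real.exp (Real.log 2 / 2), by have := log_two_pos'; positivity, fun u x hu hux => ?_⟩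
  have hl2 := log_two_pos'
  have hlu := log_pos2 hu
  have hlx := log_pos2 (hu.trans hux)
  have hu0 : 0 < u := by linarith
  have hx0 : 0 < x := by linarith
  set w := Real.log x - Real.log u with hw
  have hw0 : 0 ≤ w := sub_nonneg.2 (Real.log_le_log hu0 hux)
  have hl : Real.log 2 ≤ Real.log u := Real.log_le_log (by norm_num) hu
  have h1 : Real.log x / Real.log u ≤ (2 / Real.log 2) * (Real.log 2 / 2 + w / 2) := by
    have : Real.log x = Real.log u + w := by rw [hw]; ring
    rw [this, add_div, div_self hlu.ne']
    have : w / Real.log u ≤ w / Real.log 2 := by gcongr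
    have e : (2 / Real.log 2) * (Real.log 2 / 2 + w / 2) = 1 + w / Real.log 2 := by field_simp
    linarith
  have h2 := Real.pow_div_factorial_le_exp (Real.log 2 / 2 + w / 2) (by positivity) A
  rw [div_le_iff₀ (by positivity), Real.exp_add] at h2
  have h3 : Real.exp (w / 2) = x ^ (1/2:ℝ) * u ^ (-(1/2:ℝ)) := by
    rw [Real.rpow_def_of_pos hx0, Real.rpow_def_of_pos hu0, ← Real.exp_add, hw]; congr 1; ring
  have h4 : (Real.log x / Real.log u) ^ A ≤ (2 / Real.log 2) ^ A * A.factorial * Real.exp (Real.log 2 / 2) * (x ^ (1/2:ℝ) * u ^ (-(1/2:ℝ))) := by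
    calc _ ≤ ((2 / Real.log 2) * (Real.log 2 / 2 + w / 2)) ^ A := by gcongr
      _ = (2 / Real.log 2) ^ A * (Real.log 2 / 2 + w / 2) ^ A := mul_pow _ _ _
      _ ≤ (2 / Real.log 2) ^ A * (Real.exp (Real.log 2 / 2) * Real.exp (w/2) * A.factorial) := by gcongr
      _ = _ := by rw [h3]; ring
  rw [div_pow] at h4
  calc 1 / Real.log u ^ A = (Real.log x ^ A / Real.log u ^ A) / Real.log x ^ A := by field_simp
    _ ≤ _ := div_le_div_of_nonneg_right h4 (by positivity)
    _ = _ := by ring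

lemma one_le_xlog (A : ℕ) : ∃ C > 0, ∀ x : ℝ, 2 ≤ x → 1 ≤ C * x / Real.log x ^ A := by
  obtain ⟨C, hC, H⟩ := quasi_mono A
  have hl2 := log_two_pos'
  refine ⟨C * Real.log 2 ^ A, by positivity, fun x hx => ?_⟩
  have h := H 2 x le_rfl hx
  have hlx := log_pos2 hx
  have h1 : x ^ (1/2:ℝ) ≤ x := by
    calc x ^ (1/2:ℝ) ≤ x ^ (1:ℝ) := Real.rpow_le_rpow_of_exponent_le (by linarith) (by norm_num)
      _ = x := Real.rpow_one x
  have h2 : (2:ℝ) ^ (-(1/2:ℝ)) ≤ 1 := Real.rpow_le_one_of_one_le_of_nonpos (by norm_num) (by norm_num)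
  have h3 : 1 / Real.log 2 ^ A ≤ C * x / Real.log x ^ A * 1 := h.trans (by gcongr)
  rw [div_le_iff₀ (by positivity)] at h3
  calc 1 ≤ _ := h3
    _ = _ := by ring

lemma inv_log_int {A : ℕ} {a b : ℝ} (ha : 2 ≤ a) : IntegrableOn (fun t => 1 / Real.log t ^ A) (Icc a b) := by
  apply ContinuousOn.integrableOn_Icc
  intro t ht
  have : 2 ≤ t := ha.trans ht.1
  have h := log_pos2 this
  apply ContinuousAt.continuousWithinAt
  have : ContinuousAt Real.log t := Real.continuousAt_log (by linarith)
  fun_prop (disch := positivity)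

lemma int_log_bound (A : ℕ) : ∃ C > 0, ∀ x : ℝ, 2 ≤ x → ∫ t in Ioc 2 x, 1 / Real.log t ^ A ≤ C * x / Real.log x ^ A := by
  obtain ⟨C, hC, H⟩ := quasi_mono A
  refine ⟨2 * C, by positivity, fun x hx => ?_⟩
  have hlx := log_pos2 hx
  have hi : IntervalIntegrable (fun t : ℝ => t ^ (-(1/2:ℝ))) volume 2 x := intervalIntegral.intervalIntegrable_rpow' (by norm_num)
  have h1 : ∫ t in Ioc 2 x, 1 / Real.log t ^ A ≤ ∫ t in Ioc 2 x, C * x ^ (1/2:ℝ) / Real.log x ^ A * t ^ (-(1/2:ℝ)) := by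
    refine setIntegral_mono_on ((inv_log_int le_rfl).mono_set Ioc_subset_Icc_self) (hi.1.const_mul _) measurableSet_Ioc ?_
    intro t ht
    exact H t x ht.1.le ht.2
  refine h1.trans ?_
  rw [integral_const_mul, ← intervalIntegral.integral_of_le hx, integral_rpow (Or.inl (by norm_num))]
  norm_num
  have h2 : 0 ≤ (2:ℝ) ^ (1/2:ℝ) := by positivity
  have h3 : x ^ (1/2:ℝ) * x ^ (1/2:ℝ) = x := by rw [← Real.rpow_add (by linarith)]; norm_num
  calc _ ≤ C * x ^ (1/2:ℝ) / Real.log x ^ A * (x ^ (1/2:ℝ) * 2) := by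
        norm_num at h2 ⊢
        have : 0 ≤ x ^ (1/2:ℝ) := Real.rpow_nonneg (by linarith) _
        norm_num at this
        gcongr; linarith
    _ = 2 * C * (x ^ (1/2:ℝ) * x ^ (1/2:ℝ)) / Real.log x ^ A := by ring
    _ = _ := by rw [h3]

noncomputable def cc (n : ℕ) : ℝ := Λ n / Real.log n
noncomputable def LL (u : ℝ) : ℝ := ∫ t in (2:ℝ)..u, 1 / Real.log t

lemma abel_E {m : ℕ} (hm : 1 ≤ m) : ∃ C > 0, ∀ x ≥ 2,
    |SS (fun n => (Λ n - 1) / Real.log n) x| ≤ C * x / Real.log x ^ (m+1) := by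
  obtain ⟨C, hC, H⟩ := psi_bound hm
  obtain ⟨D, hD, HD⟩ := int_log_bound (m+2)
  have hl2 := log_two_pos'
  refine ⟨C + (2*m+1) * C * D / Real.log 2, by positivity, fun x hx => ?_⟩
  set a : ℕ → ℝ := fun n => (Λ n - 1) * Real.log n ^ (2*m) with ha
  set f : ℝ → ℝ := fun t => (Real.log t ^ (2*m+1))⁻¹ with hf
  have hlx := log_pos2 hx
  have hder : ∀ t : ℝ, 2 ≤ t → HasDerivAt f (-((2*m+1) / (t * Real.log t ^ (2*m+2)))) t := by
    intro t ht
    have hlt := log_pos2 ht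
    have : HasDerivAt f _ t := ((Real.hasDerivAt_log (by linarith : t ≠ 0)).pow (2*m+1)).inv (pow_ne_zero _ hlt.ne')
    refine this.congr_deriv ?_
    simp only [Pi.pow_apply]
    push_cast
    field_simp
    ring
  have hd : ∀ t ∈ Icc 2 x, DifferentiableAt ℝ f t := fun t ht => (hder t ht.1).differentiableAt
  have hdi : IntegrableOn (deriv f) (Icc 2 x) := by
    have : IntegrableOn (fun t => -((2*m+1) / (t * Real.log t ^ (2*m+2)))) (Icc 2 x) := by
      apply ContinuousOn.integrableOn_Icc
      intro t ht
      have h := log_pos2 ht.1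
      have h0 : 0 < t := by linarith [ht.1]
      apply ContinuousAt.continuousWithinAt
      have : ContinuousAt Real.log t := Real.continuousAt_log (by linarith)
      fun_prop (disch := positivity)
    exact this.congr_fun (fun t ht => (hder t ht.1).deriv.symm) measurableSet_Icc
  have h0 := sum_mul_eq_sub_integral_mul₁ a (f := f) (by simp [ha]; omega) (by simp [ha]; omega) x hd hdi
  have e1 : ∑ k ∈ Finset.Icc 0 ⌊x⌋₊, f k * a k = SS (fun n => (Λ n - 1) / Real.log n) x := by
    refine Finset.sum_congr rfl fun n _ => ?_
    simp only [hf, ha]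
    by_cases hn : Real.log n = 0
    · simp [hn]
    · field_simp
      ring
  rw [e1] at h0
  have h1 : |f x * SS a x| ≤ C * x / Real.log x ^ (m+1) := by
    rw [abs_mul, abs_of_pos (show 0 < f x by simp only [hf]; positivity)]
    calc _ ≤ f x * (C * x * Real.log x ^ m) := mul_le_mul_of_nonneg_left (H x hx) (by simp only [hf]; positivity)
      _ = _ := by simp only [hf]; field_simp; ring
  have h2 : |∫ t in Ioc 2 x, deriv f t * ∑ k ∈ Finset.Icc 0 ⌊t⌋₊, a k| ≤ ∫ t in Ioc 2 x, ((2*m+1) * C) * (1 / Real.log t ^ (m+2)) := by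
    rw [← Real.norm_eq_abs]
    refine norm_integral_le_of_norm_le (((inv_log_int le_rfl).mono_set Ioc_subset_Icc_self).const_mul _) ?_
    rw [ae_restrict_iff' measurableSet_Ioc]
    refine Eventually.of_forall fun t ht => ?_
    have h := log_pos2 ht.1.le
    have h0 : 0 < t := by linarith [ht.1]
    rw [(hder t ht.1.le).deriv, norm_mul, norm_neg, Real.norm_of_nonneg (by positivity), Real.norm_eq_abs]
    have := H t ht.1.le
    rw [SS] at this
    calc _ ≤ (2*m+1) / (t * Real.log t ^ (2*m+2)) * (C * t * Real.log t ^ m) := by gcongr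
      _ = _ := by field_simp; ring
  rw [integral_const_mul] at h2
  have h3 : (2*m+1) * C * ∫ t in Ioc 2 x, (1 / Real.log t ^ (m+2)) ≤ (2*m+1) * C * D / Real.log 2 * x / Real.log x ^ (m+1) := by
    calc _ ≤ (2*m+1) * C * (D * x / Real.log x ^ (m+2)) := by gcongr; exact HD x hx
      _ = (2*m+1) * C * D * x / Real.log x ^ (m+1) / Real.log x := by field_simp; ring
      _ ≤ (2*m+1) * C * D * x / Real.log x ^ (m+1) / Real.log 2 := by gcongr
      _ = _ := by ring
  rw [h0]
  calc _ ≤ |f x * SS a x| + |∫ t in Ioc 2 x, deriv f t * ∑ k ∈ Finset.Icc 0 ⌊t⌋₊, a k| := abs_sub _ _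
    _ ≤ C * x / Real.log x ^ (m+1) + (2*m+1) * C * D / Real.log 2 * x / Real.log x ^ (m+1) := by
      linarith
    _ = _ := by ring

lemma inv_log_ii {a b : ℝ} (ha : 2 ≤ a) (hb : 2 ≤ b) : IntervalIntegrable (fun t => 1 / Real.log t) volume a b := by
  apply ContinuousOn.intervalIntegrable
  intro t ht
  have : 2 ≤ t := (le_min ha hb).trans ht.1
  have h := log_pos2 this
  apply ContinuousAt.continuousWithinAt
  have : ContinuousAt Real.log t := Real.continuousAt_log (by linarith)
  fun_prop (disch := positivity)

lemma inv_log_anti {a b : ℝ} (ha : 2 ≤ a) : AntitoneOn (fun t => 1 / Real.log t) (Icc a b) := by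
  intro s hs t ht hst
  have := log_pos2 (ha.trans hs.1)
  exact one_div_le_one_div_of_le this (Real.log_le_log (by linarith [hs.1]) hst)

lemma sum_inv_log {x : ℝ} (hx : 2 ≤ x) : |SS (fun n => 1 / Real.log n) x - LL x| ≤ 1 / Real.log 2 := by
  set N := ⌊x⌋₊ with hN
  have hl2 := log_two_pos'
  have hN2 : 2 ≤ N := Nat.le_floor (by exact_mod_cast hx)
  have hN2' : (2:ℝ) ≤ N := by exact_mod_cast hN2
  have hNx : (N:ℝ) ≤ x := Nat.floor_le (by linarith)
  have hxN : x < N + 1 := Nat.lt_floor_add_one x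
  have a1 := AntitoneOn.integral_le_sum_Ico (f := fun t => 1 / Real.log t) hN2 (inv_log_anti (by norm_num))
  have a2 := AntitoneOn.sum_le_integral_Ico (f := fun t => 1 / Real.log t) hN2 (inv_log_anti (by norm_num))
  have hsplit : LL x = (∫ t in ((2:ℕ):ℝ)..N, 1 / Real.log t) + ∫ t in (N:ℝ)..x, 1 / Real.log t := by
    rw [LL, Nat.cast_two]
    exact (intervalIntegral.integral_add_adjacent_intervals (inv_log_ii le_rfl hN2') (inv_log_ii hN2' hx)).symm
  have b1 : 0 ≤ ∫ t in (N:ℝ)..x, 1 / Real.log t := by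
    apply intervalIntegral.integral_nonneg hNx
    intro t ht
    have := log_pos2 (hN2'.trans ht.1)
    positivity
  have b2 : ∫ t in (N:ℝ)..x, 1 / Real.log t ≤ 1 / Real.log N := by
    have hlN := log_pos2 hN2'
    calc _ ≤ ∫ t in (N:ℝ)..x, 1 / Real.log N := by
          apply intervalIntegral.integral_mono_on hNx (inv_log_ii hN2' hx) (by simp)
          intro t ht
          exact one_div_le_one_div_of_le hlN (Real.log_le_log (by linarith) ht.1)
      _ = (x - N) * (1 / Real.log N) := by simp
      _ ≤ 1 * (1 / Real.log N) := by gcongr; linarith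
      _ = _ := one_mul _
  have c1 : SS (fun n => 1 / Real.log n) x = ∑ n ∈ Finset.Ico 2 (N+1), 1 / Real.log n := by
    rw [SS]
    symm
    apply Finset.sum_subset
    · intro n hn; simp at hn ⊢; omega
    · intro n hn hn'
      have : n = 0 ∨ n = 1 := by simp at hn hn'; omega
      rcases this with rfl | rfl <;> simp
  have c2 : ∑ n ∈ Finset.Ico 2 (N+1), 1 / Real.log n = ∑ n ∈ Finset.Ico 2 N, 1 / Real.log n + 1 / Real.log N :=
    Finset.sum_Ico_succ_top hN2 _
  have c3 : ∑ n ∈ Finset.Ico 2 (N+1), 1 / Real.log n = 1 / Real.log (2:ℕ) + ∑ n ∈ Finset.Ico 2 N, 1 / Real.log (n+1:ℕ) := by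
    rw [Finset.sum_eq_sum_Ico_succ_bot (by omega), Finset.sum_Ico_add' (fun n : ℕ => 1 / Real.log n) 2 N 1]
  rw [abs_le, c1]
  have hl : 1 / Real.log N ≤ 1 / Real.log 2 := one_div_le_one_div_of_le hl2 (Real.log_le_log (by norm_num) hN2')
  have hpos : 0 < 1 / Real.log 2 := by positivity
  constructor
  · rw [hsplit, c2]; linarith
  · rw [hsplit, c3]; simp only [Nat.cast_two]; linarith

noncomputable def EE (u : ℝ) : ℝ := SS cc u - LL u

theorem EE_bound (A : ℕ) : ∃ C > 0, ∀ x ≥ 2, |EE x| ≤ C * x / Real.log x ^ A := by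
  obtain ⟨C, hC, H⟩ := abel_E (m := A + 1) (by omega)
  obtain ⟨D, hD, HD⟩ := one_le_xlog A
  have hl2 := log_two_pos'
  refine ⟨C / Real.log 2 ^ 2 + D / Real.log 2, by positivity, fun x hx => ?_⟩
  have hlx := log_pos2 hx
  have h1 := H x hx
  have h2 := sum_inv_log hx
  have e : EE x = SS (fun n => (Λ n - 1) / Real.log n) x + (SS (fun n => 1 / Real.log n) x - LL x) := by
    rw [EE, ← add_sub_assoc]; congr 1
    rw [SS, SS, SS, ← Finset.sum_add_distrib]
    exact Finset.sum_congr rfl fun n _ => by rw [cc]; ring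
  rw [e]
  refine (abs_add_le _ _).trans ?_
  have h3 : C * x / Real.log x ^ (A+1+1) ≤ C / Real.log 2 ^ 2 * x / Real.log x ^ A := by
    calc _ = C * x / Real.log x ^ A / Real.log x ^ 2 := by field_simp; ring
      _ ≤ C * x / Real.log x ^ A / Real.log 2 ^ 2 := by gcongr
      _ = _ := by ring
  have h4 : 1 / Real.log 2 ≤ D / Real.log 2 * x / Real.log x ^ A := by
    calc 1 / Real.log 2 ≤ (D * x / Real.log x ^ A) / Real.log 2 := by gcongr; exact HD x hx
      _ = _ := by ring
  calc _ ≤ C / Real.log 2 ^ 2 * x / Real.log x ^ A + D / Real.log 2 * x / Real.log x ^ A := by linarith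
    _ = _ := by ring

end

section
open Complex Set Filter Topology MeasureTheory Asymptotics
open scoped ArithmeticFunction.vonMangoldt

lemma cc_nonneg (n : ℕ) : 0 ≤ cc n := div_nonneg ArithmeticFunction.vonMangoldt_nonneg (Real.log_natCast_nonneg n)
lemma cc_le (n : ℕ) : cc n ≤ 1 := div_le_one_of_le₀ ArithmeticFunction.vonMangoldt_le_log (Real.log_natCast_nonneg n)
lemma cc_zero : cc 0 = 0 := by simp [cc]
lemma cc_one : cc 1 = 0 := by simp [cc]

lemma LL_deriv {u : ℝ} (hu : 2 ≤ u) : HasDerivAt LL (1 / Real.log u) u := by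
  have hl := log_pos2 hu
  refine intervalIntegral.integral_hasDerivAt_right (inv_log_ii le_rfl hu) ?_ ?_
  · have : Measurable (fun t : ℝ => 1 / Real.log t) := by fun_prop
    exact this.stronglyMeasurable.stronglyMeasurableAtFilter
  · have : ContinuousAt Real.log u := Real.continuousAt_log (by linarith)
    fun_prop (disch := positivity)

lemma SS_meas (a : ℕ → ℝ) : Measurable (SS a) := by
  have : Measurable (fun m : ℕ => ∑ n ∈ Finset.Icc 0 m, a n) := measurable_from_top
  exact this.comp Nat.measurable_floor

lemma int_aux : IntegrableOn (fun u : ℝ => 1 / (u * Real.log u ^ 2)) (Ioi 2) := by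
  have hl2 := log_two_pos'
  refine integrableOn_Ioi_deriv_of_nonneg (g := fun u => -(Real.log u)⁻¹) (l := 0) ?_ (fun u hu => ?_) (fun u hu => ?_) ?_
  · have : ContinuousAt Real.log 2 := Real.continuousAt_log (by norm_num)
    apply ContinuousAt.continuousWithinAt
    fun_prop (disch := positivity)
  · have h := log_pos2 (le_of_lt hu)
    have h0 : (0:ℝ) < u := by linarith [show (2:ℝ) < u from hu]
    have := ((Real.hasDerivAt_log h0.ne').inv h.ne').neg
    refine this.congr_deriv ?_
    field_simp
  · have h := log_pos2 (le_of_lt hu)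
    have h0 : (0:ℝ) < u := by linarith [show (2:ℝ) < u from hu]
    positivity
  · have := (Real.tendsto_log_atTop.inv_tendsto_atTop).neg
    simpa using this

lemma EE_meas : AEStronglyMeasurable (fun u => EE u / u ^ 2) (volume.restrict (Ioi 2)) := by
  have h1 : AEStronglyMeasurable LL (volume.restrict (Ioi 2)) := by
    apply ContinuousOn.aestronglyMeasurable _ measurableSet_Ioi
    intro u hu
    exact (LL_deriv (le_of_lt hu)).continuousAt.continuousWithinAt
  have h2 : AEStronglyMeasurable (fun u => EE u) (volume.restrict (Ioi 2)) :=
    ((SS_meas cc).aestronglyMeasurable).sub h1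
  have h3 : Measurable (fun u : ℝ => (u^2)⁻¹) := by fun_prop
  simp_rw [div_eq_mul_inv]
  exact h2.mul h3.aestronglyMeasurable

lemma EE_pt (A : ℕ) : ∃ C > 0, ∀ y u : ℝ, 2 ≤ y → y ≤ u → ‖EE u / u ^ 2‖ ≤ C / Real.log y ^ A * (1 / (u * Real.log u ^ 2)) := by
  obtain ⟨C, hC, H⟩ := EE_bound (A + 2)
  refine ⟨C, hC, fun y u hy hu => ?_⟩
  have h := H u (hy.trans hu)
  have hly := log_pos2 hy
  have hlu := log_pos2 (hy.trans hu)
  have hle : Real.log y ≤ Real.log u := Real.log_le_log (by linarith) hu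
  have hu0 : 0 < u := by linarith
  rw [norm_div, Real.norm_eq_abs, Real.norm_of_nonneg (by positivity : (0:ℝ) ≤ u^2)]
  calc |EE u| / u ^ 2 ≤ C * u / Real.log u ^ (A+2) / u ^ 2 := by gcongr
    _ = C / Real.log u ^ A * (1 / (u * Real.log u ^ 2)) := by field_simp; ring
    _ ≤ _ := by gcongr

lemma EE_int : IntegrableOn (fun u => EE u / u ^ 2) (Ioi 2) := by
  obtain ⟨C, hC, H⟩ := EE_pt 0
  refine (int_aux.const_mul C).mono' EE_meas ?_
  rw [ae_restrict_iff' measurableSet_Ioi]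
  refine Eventually.of_forall fun u hu => ?_
  simpa using H 2 u le_rfl (le_of_lt hu)

noncomputable def DD : ℝ := - Real.log (Real.log 2) + ∫ u in Ioi 2, EE u / u ^ 2
noncomputable def MM (y : ℝ) : ℝ := SS (fun n => cc n / n) y

lemma inv_ulog_ii {a b : ℝ} (ha : 2 ≤ a) (hb : 2 ≤ b) : IntervalIntegrable (fun t => 1 / (t * Real.log t)) volume a b := by
  apply ContinuousOn.intervalIntegrable
  intro t ht
  have : 2 ≤ t := (le_min ha hb).trans ht.1
  have h := log_pos2 this
  apply ContinuousAt.continuousWithinAt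
  have h0 : t ≠ 0 := by linarith
  have : ContinuousAt Real.log t := Real.continuousAt_log h0
  fun_prop (disch := positivity)

lemma int_loglog {a b : ℝ} (ha : 2 ≤ a) (hab : a ≤ b) : ∫ t in a..b, 1 / (t * Real.log t) = Real.log (Real.log b) - Real.log (Real.log a) := by
  rw [intervalIntegral.integral_eq_sub_of_hasDerivAt (f := fun t => Real.log (Real.log t)) _ (inv_ulog_ii ha (ha.trans hab))]
  intro t ht
  rw [uIcc_of_le hab] at ht
  have h := log_pos2 (ha.trans ht.1)
  have h0 : t ≠ 0 := by linarith [ha.trans ht.1]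
  have := (Real.hasDerivAt_log h0).log h.ne'
  refine this.congr_deriv ?_
  field_simp

lemma MM_eq {y : ℝ} (hy : 2 ≤ y) : MM y - Real.log (Real.log y) = - Real.log (Real.log 2) + EE y / y + ∫ u in Ioc 2 y, EE u / u ^ 2 := by
  have hy0 : 0 < y := by linarith
  have hd : ∀ t ∈ Icc 2 y, HasDerivAt (fun t : ℝ => t⁻¹) (-(t^2)⁻¹) t := fun t ht =>
    hasDerivAt_inv (by linarith [ht.1])
  have hc : ContinuousOn (fun t : ℝ => -(t^2)⁻¹) (Icc 2 y) := by
    intro t ht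
    have : 0 < t := by linarith [ht.1]
    apply ContinuousAt.continuousWithinAt
    fun_prop (disch := positivity)
  have h0 := sum_mul_eq_sub_integral_mul₁ cc (f := fun t : ℝ => t⁻¹) cc_zero cc_one y
    (fun t ht => (hd t ht).differentiableAt) ((hc.integrableOn_Icc).congr_fun (fun t ht => (hd t ht).deriv.symm) measurableSet_Icc)
  have e0 : ∑ k ∈ Finset.Icc 0 ⌊y⌋₊, (k:ℝ)⁻¹ * cc k = MM y :=
    Finset.sum_congr rfl fun n _ => by ring
  have hE : IntegrableOn (fun u => EE u / u ^ 2) (Ioc 2 y) := EE_int.mono_set Ioc_subset_Ioi_self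
  have hL : IntervalIntegrable (fun u => LL u / u ^ 2) volume 2 y := by
    apply ContinuousOn.intervalIntegrable
    rw [uIcc_of_le hy]
    intro t ht
    have h1 := (LL_deriv ht.1).continuousAt
    have : 0 < t := by linarith [ht.1]
    apply ContinuousAt.continuousWithinAt
    fun_prop (disch := positivity)
  have e1 : ∫ t in Ioc 2 y, deriv (fun t : ℝ => t⁻¹) t * ∑ k ∈ Finset.Icc 0 ⌊t⌋₊, cc k = -((∫ u in Ioc 2 y, EE u / u ^ 2) + ∫ u in Ioc 2 y, LL u / u^2) := by
    rw [← integral_add hE hL.1, ← integral_neg]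
    refine setIntegral_congr_fun measurableSet_Ioc fun t ht => ?_
    rw [(hd t (Ioc_subset_Icc_self ht)).deriv, EE, SS]; ring
  have e2 := intervalIntegral.integral_mul_deriv_eq_deriv_mul (a := 2) (b := y) (u := LL) (v := fun t => t⁻¹) (u' := fun t => 1 / Real.log t)
    (v' := fun t => -(t^2)⁻¹) (fun t ht => by rw [uIcc_of_le hy] at ht; exact LL_deriv ht.1) (fun t ht => by rw [uIcc_of_le hy] at ht; exact hd t ht)
    (inv_log_ii le_rfl hy) (by apply ContinuousOn.intervalIntegrable; rwa [uIcc_of_le hy])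
  have e3 : ∫ t in (2:ℝ)..y, LL t * -(t^2)⁻¹ = - ∫ u in Ioc 2 y, LL u / u^2 := by
    rw [← intervalIntegral.integral_of_le hy, ← intervalIntegral.integral_neg]
    exact intervalIntegral.integral_congr fun t _ => by ring
  have e4 : ∫ t in (2:ℝ)..y, 1 / Real.log t * t⁻¹ = Real.log (Real.log y) - Real.log (Real.log 2) := by
    rw [← int_loglog le_rfl hy]
    exact intervalIntegral.integral_congr fun t _ => by rw [div_mul_eq_mul_div, div_eq_mul_inv, one_mul, one_div, mul_inv]
  have e5 : LL 2 = 0 := by simp [LL]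
  rw [e3, e4, e5] at e2
  rw [e0, e1] at h0
  rw [h0, show ∑ k ∈ Finset.Icc 0 ⌊y⌋₊, cc k = EE y + LL y by rw [EE, SS]; ring]
  have e6 : y⁻¹ * (EE y + LL y) = EE y / y + LL y * y⁻¹ := by ring
  linarith

theorem MM_asym (A : ℕ) : ∃ C > 0, ∀ y ≥ 2, |MM y - Real.log (Real.log y) - DD| ≤ C / Real.log y ^ A := by
  obtain ⟨C1, hC1, H1⟩ := EE_bound A
  obtain ⟨C2, hC2, H2⟩ := EE_pt A
  set J := ∫ u in Ioi (2:ℝ), 1 / (u * Real.log u ^ 2) with hJ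
  have hnn : ∀ u ∈ Ioi (2:ℝ), 0 ≤ 1 / (u * Real.log u ^ 2) := fun u hu => by
    have h := log_pos2 (le_of_lt hu)
    have h0 : (0:ℝ) < u := by linarith [show (2:ℝ) < u from hu]
    positivity
  have hJ0 : 0 ≤ J := setIntegral_nonneg measurableSet_Ioi hnn
  refine ⟨C1 + C2 * J, by positivity, fun y hy => ?_⟩
  have hly := log_pos2 hy
  have hy0 : 0 < y := by linarith
  have h1 : ∫ u in Ioi 2, EE u / u ^ 2 = (∫ u in Ioc 2 y, EE u / u ^ 2) + ∫ u in Ioi y, EE u / u ^ 2 := by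
    rw [← setIntegral_union (Ioc_disjoint_Ioi le_rfl) measurableSet_Ioi (EE_int.mono_set Ioc_subset_Ioi_self)
      (EE_int.mono_set (Ioi_subset_Ioi hy)), Ioc_union_Ioi_eq_Ioi hy]
  have h2 : MM y - Real.log (Real.log y) - DD = EE y / y - ∫ u in Ioi y, EE u / u ^ 2 := by
    rw [MM_eq hy, DD, h1]; ring
  have h3 : |∫ u in Ioi y, EE u / u ^ 2| ≤ C2 / Real.log y ^ A * J := by
    rw [← Real.norm_eq_abs]
    calc _ ≤ ∫ u in Ioi y, C2 / Real.log y ^ A * (1 / (u * Real.log u ^ 2)) := by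
          refine norm_integral_le_of_norm_le ((int_aux.mono_set (Ioi_subset_Ioi hy)).const_mul _) ?_
          rw [ae_restrict_iff' measurableSet_Ioi]
          exact Eventually.of_forall fun u hu => H2 y u hy (le_of_lt hu)
      _ = C2 / Real.log y ^ A * ∫ u in Ioi y, (1 / (u * Real.log u ^ 2)) := integral_const_mul _ _
      _ ≤ _ := by
        refine mul_le_mul_of_nonneg_left ?_ (by positivity)
        apply setIntegral_mono_set int_aux _ (Ioi_subset_Ioi hy).eventuallyLE
        rw [EventuallyLE, ae_restrict_iff' measurableSet_Ioi]
        exact Eventually.of_forall hnn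
  have h4 : |EE y / y| ≤ C1 / Real.log y ^ A := by
    rw [abs_div, abs_of_pos hy0, div_le_iff₀ hy0]
    refine (H1 y hy).trans (le_of_eq (by ring))
  rw [h2]
  calc _ ≤ |EE y / y| + |∫ u in Ioi y, EE u / u ^ 2| := abs_sub _ _
    _ ≤ C1 / Real.log y ^ A + C2 / Real.log y ^ A * J := add_le_add h4 h3
    _ = _ := by ring

end

section
open Complex Set Filter Topology MeasureTheory Asymptotics
open scoped ArithmeticFunction.vonMangoldt

lemma log_pow_le (k : ℕ) {t : ℝ} (ht : 1 ≤ t) : Real.log t ^ k ≤ 4 ^ k * k.factorial * t ^ (1/4 : ℝ) := by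
  have h0 : 0 < t := by linarith
  have hl := Real.log_nonneg ht
  have h := Real.pow_div_factorial_le_exp (Real.log t / 4) (by positivity) k
  rw [div_le_iff₀ (by positivity), show Real.exp (Real.log t / 4) = t ^ (1/4:ℝ) by
    rw [Real.rpow_def_of_pos h0]; congr 1; ring, div_pow, div_le_iff₀ (by positivity)] at h
  linarith

lemma logpow_int (k : ℕ) : IntegrableOn (fun t : ℝ => Real.log t ^ k * t ^ (-(3/2) : ℝ)) (Ioi 1) := by
  have h := (integrableOn_Ioi_rpow_of_lt (a := -(5/4)) (by norm_num) (c := (1:ℝ)) one_pos).const_mul (4 ^ k * k.factorial : ℝ)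
  refine h.mono' ?_ ?_
  · exact ((Real.measurable_log.pow_const k).mul (measurable_id.pow_const _)).aestronglyMeasurable
  rw [ae_restrict_iff' measurableSet_Ioi]
  refine Eventually.of_forall fun t ht => ?_
  have ht : 1 < t := ht
  have h0 : 0 < t := by linarith
  have hl := Real.log_nonneg ht.le
  rw [Real.norm_of_nonneg (by positivity), show (-(5/4):ℝ) = 1/4 + -(3/2) by norm_num, Real.rpow_add h0, ← mul_assoc]
  exact mul_le_mul_of_nonneg_right (log_pow_le k ht.le) (by positivity)

lemma sq_le_rpow {t : ℝ} (ht : 1 ≤ t) : 1 / t ^ 2 ≤ t ^ (-(3/2) : ℝ) := by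
  rw [one_div, ← Real.rpow_natCast, ← Real.rpow_neg (by linarith)]
  exact Real.rpow_le_rpow_of_exponent_le ht (by norm_num)

lemma geom_exp (N : ℕ) {l w : ℝ} (hl : 0 < l) (hw : w < l) :
    1 / (l - w) = ∑ j ∈ Finset.Icc 1 N, w ^ (j-1) / l ^ j + w ^ N / (l ^ N * (l - w)) := by
  have : 0 < l - w := by linarith
  induction N with
  | zero => simp
  | succ n ih =>
    rw [Finset.sum_Icc_succ_top (by omega), ih, add_assoc]
    congr 1
    rw [Nat.add_sub_cancel]
    field_simp
    ring

noncomputable def II (j : ℕ) : ℝ := ∫ t in Ioi (1:ℝ), (t - (⌊t⌋₊:ℝ)) * Real.log t ^ (j-1) / t ^ 2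

lemma II_int (k : ℕ) : IntegrableOn (fun t : ℝ => (t - (⌊t⌋₊:ℝ)) * Real.log t ^ k / t ^ 2) (Ioi 1) := by
  refine (logpow_int k).mono' ?_ ?_
  · have := fr_meas
    exact ((this.mul (Real.measurable_log.pow_const k)).div (measurable_id.pow_const _)).aestronglyMeasurable
  rw [ae_restrict_iff' measurableSet_Ioi]
  refine Eventually.of_forall fun t ht => ?_
  have ht : 1 < t := ht
  have h0 : 0 < t := by linarith
  have hl := Real.log_nonneg ht.le
  have h1 := fr_nonneg h0.le
  have h2 := fr_le (u := t)
  rw [Real.norm_of_nonneg (by positivity), mul_div_assoc]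
  have := sq_le_rpow ht.le
  calc _ ≤ 1 * (Real.log t ^ k / t ^ 2) := by gcongr
    _ = Real.log t ^ k * (1 / t ^ 2) := by ring
    _ ≤ _ := by gcongr

/-- expansion of the fractional part integral. -/
lemma frac_exp (N : ℕ) : ∃ C > 0, ∀ l T : ℝ, 1 ≤ l → 1 ≤ T → Real.log T ≤ l / 2 → l ^ (N+1) ≤ T ^ (1/2 : ℝ) →
    |(∫ t in Ioo 1 T, (t - (⌊t⌋₊:ℝ)) / (t ^ 2 * (l - Real.log t))) - ∑ j ∈ Finset.Icc 1 N, II j / l ^ j| ≤ C / l ^ (N+1) := by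
  set B : ℝ → ℝ := fun t => 2 * (Real.log t ^ N * t ^ (-(3/2) : ℝ)) + ∑ j ∈ Finset.Icc 1 N, Real.log t ^ (j-1) * t ^ (-(3/2) : ℝ) with hB
  have hBi : IntegrableOn B (Ioi 1) :=
    ((logpow_int N).const_mul 2).add (integrable_finsetSum _ fun j _ => logpow_int (j-1))
  have hBn : ∀ t ∈ Ioi (1:ℝ), 0 ≤ B t := fun t ht => by
    have ht : 1 < t := ht
    have hl := Real.log_nonneg ht.le
    have h0 : 0 < t := by linarith
    simp only [hB]; positivity
  refine ⟨(∫ t in Ioi 1, B t) + 1, by linarith [setIntegral_nonneg (μ := volume) measurableSet_Ioi hBn], fun l T hl hT hlT hTT => ?_⟩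
  have hl0 : 0 < l := by linarith
  set h : ℝ → ℝ := fun t => (t - (⌊t⌋₊:ℝ)) / (t ^ 2 * (l - Real.log t)) with hh
  set g : ℝ → ℝ := fun t => ∑ j ∈ Finset.Icc 1 N, (t - (⌊t⌋₊:ℝ)) * Real.log t ^ (j-1) / t ^ 2 / l ^ j with hg
  have hgi : IntegrableOn g (Ioi 1) := integrable_finsetSum _ fun j _ => (II_int (j-1)).div_const _
  have hgI : ∫ t in Ioi 1, g t = ∑ j ∈ Finset.Icc 1 N, II j / l ^ j := by
    rw [integral_finsetSum _ fun j _ => (II_int (j-1)).div_const _]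
    exact Finset.sum_congr rfl fun j _ => integral_div _ _
  have hhm : Measurable h := fr_meas.div ((measurable_id.pow_const _).mul (measurable_const.sub Real.measurable_log))
  set H := (Ioo 1 T).indicator h with hH
  have hHm : Measurable H := hhm.indicator measurableSet_Ioo
  have hHI : ∫ t in Ioi 1, H t = ∫ t in Ioo 1 T, h t := by
    rw [hH, setIntegral_indicator measurableSet_Ioo, inter_eq_right.2 Ioo_subset_Ioi_self]
  have hpt : ∀ t ∈ Ioi (1:ℝ), ‖H t - g t‖ ≤ B t / l ^ (N+1) := by
    intro t ht
    have ht : 1 < t := ht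
    have h0 : 0 < t := by linarith
    have hlt := Real.log_nonneg ht.le
    have h1 := fr_nonneg h0.le
    have h2 := fr_le (u := t)
    have h3 := sq_le_rpow ht.le
    by_cases htT : t < T
    · have hw : Real.log t ≤ l / 2 := (Real.log_le_log h0 htT.le).trans hlT
      have hlw : 0 < l - Real.log t := by linarith
      have e1 : H t - g t = (t - (⌊t⌋₊:ℝ)) * (1 / t ^ 2) * (Real.log t ^ N / (l ^ N * (l - Real.log t))) := by
        rw [hH, indicator_of_mem (show t ∈ Ioo 1 T from ⟨ht, htT⟩)]
        have := geom_exp N hl0 (show Real.log t < l by linarith)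
        have e2 : h t = (t - (⌊t⌋₊:ℝ)) * (1 / t ^ 2) * (1 / (l - Real.log t)) := by
          simp only [hh]; field_simp
        have e3 : g t = (t - (⌊t⌋₊:ℝ)) * (1 / t ^ 2) * ∑ j ∈ Finset.Icc 1 N, Real.log t ^ (j-1) / l ^ j := by
          simp only [hg]; rw [Finset.mul_sum]; exact Finset.sum_congr rfl fun j _ => by ring
        rw [e2, e3, this]; ring
      rw [e1, Real.norm_of_nonneg (by positivity)]
      calc _ ≤ 1 * t ^ (-(3/2) : ℝ) * (Real.log t ^ N / (l ^ N * (l / 2))) := by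
            gcongr; linarith
        _ = 2 * (Real.log t ^ N * t ^ (-(3/2) : ℝ)) / l ^ (N+1) := by field_simp; try ring
        _ ≤ _ := by
          gcongr
          simp only [hB]
          have : 0 ≤ ∑ j ∈ Finset.Icc 1 N, Real.log t ^ (j-1) * t ^ (-(3/2) : ℝ) := by positivity
          linarith
    · push Not at htT
      rw [hH, indicator_of_notMem (fun h => absurd h.2 (not_lt.2 htT)), zero_sub, norm_neg]
      have hg0 : 0 ≤ g t := by simp only [hg]; positivity
      have h4 : 1 / t ^ 2 ≤ t ^ (-(3/2) : ℝ) / l ^ (N+1) := by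
        rw [le_div_iff₀ (by positivity)]
        calc 1 / t ^ 2 * l ^ (N+1) ≤ 1 / t ^ 2 * t ^ (1/2 : ℝ) := by
              gcongr; exact hTT.trans (Real.rpow_le_rpow (by linarith) htT (by norm_num))
          _ = _ := by
            rw [one_div, ← Real.rpow_natCast, ← Real.rpow_neg h0.le, ← Real.rpow_add h0]; norm_num
      rw [Real.norm_of_nonneg hg0]
      calc g t ≤ ∑ j ∈ Finset.Icc 1 N, Real.log t ^ (j-1) * t ^ (-(3/2) : ℝ) / l ^ (N+1) := by
            simp only [hg]
            refine Finset.sum_le_sum fun j _ => ?_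
            have : 1 ≤ l ^ j := one_le_pow₀ hl
            calc _ ≤ (t - (⌊t⌋₊:ℝ)) * Real.log t ^ (j-1) / t ^ 2 := div_le_self (by positivity) this
              _ = (t - (⌊t⌋₊:ℝ)) * (Real.log t ^ (j-1) * (1 / t ^ 2)) := by ring
              _ ≤ 1 * (Real.log t ^ (j-1) * (t ^ (-(3/2) : ℝ) / l ^ (N+1))) := by gcongr
              _ = _ := by ring
        _ = (∑ j ∈ Finset.Icc 1 N, Real.log t ^ (j-1) * t ^ (-(3/2) : ℝ)) / l ^ (N+1) := by rw [Finset.sum_div]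
        _ ≤ _ := by
          gcongr
          simp only [hB]
          have : 0 ≤ 2 * (Real.log t ^ N * t ^ (-(3/2) : ℝ)) := by positivity
          linarith
  have hae : ∀ᵐ t ∂(volume.restrict (Ioi (1:ℝ))), ‖H t - g t‖ ≤ B t / l ^ (N+1) := by
    rw [ae_restrict_iff' measurableSet_Ioi]
    exact Eventually.of_forall hpt
  have hdi : IntegrableOn (fun t => H t - g t) (Ioi 1) :=
    (hBi.div_const _).mono' (hHm.aestronglyMeasurable.sub hgi.1) hae
  have hHi : IntegrableOn H (Ioi 1) := by
    refine (hdi.add hgi).congr_fun (fun t _ => by simp) measurableSet_Ioi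
  rw [← hHI, ← hgI, ← integral_sub hHi hgi, ← Real.norm_eq_abs]
  refine (norm_integral_le_of_norm_le (hBi.div_const _) hae).trans ?_
  rw [integral_div]
  gcongr
  linarith

end

section
open Complex Set Filter Topology MeasureTheory Asymptotics
open scoped ArithmeticFunction.vonMangoldt

lemma floor_sum {v : ℝ} (hv : 0 ≤ v) {T : ℕ} (hT : v ≤ T) :
    (⌊v⌋₊ : ℝ) = ∑ m ∈ Finset.Icc 1 T, if (m:ℝ) ≤ v then (1:ℝ) else 0 := by
  rw [Finset.sum_ite, Finset.sum_const_zero, add_zero, Finset.sum_const, nsmul_eq_mul, mul_one]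
  congr 1
  have : (Finset.Icc 1 T).filter (fun m : ℕ => (m:ℝ) ≤ v) = Finset.Icc 1 ⌊v⌋₊ := by
    ext m
    simp only [Finset.mem_filter, Finset.mem_Icc]
    have hf : ⌊v⌋₊ ≤ T := by
      have := Nat.floor_le hv
      exact_mod_cast this.trans hT
    rw [← Nat.le_floor_iff hv]
    omega
  rw [this]; simp

lemma SS_sub {a : ℕ → ℝ} {y z : ℝ} (h : y ≤ z) : SS a z - SS a y = ∑ n ∈ Finset.Ioc ⌊y⌋₊ ⌊z⌋₊, a n := by
  have := Nat.floor_mono h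
  rw [SS, SS, sub_eq_iff_eq_add]
  have e : Finset.Icc 0 ⌊z⌋₊ = Finset.Ioc ⌊y⌋₊ ⌊z⌋₊ ∪ Finset.Icc 0 ⌊y⌋₊ := by
    ext n; simp only [Finset.mem_Icc, Finset.mem_union, Finset.mem_Ioc]; omega
  rw [e, Finset.sum_union]
  rw [Finset.disjoint_left]
  intro n; simp only [Finset.mem_Icc, Finset.mem_Ioc]; omega

lemma hyp_sum {x : ℝ} {T : ℕ} (hx : 0 < x) (hT : 1 ≤ T) :
    ∑ n ∈ Finset.Ioc ⌊x / T⌋₊ ⌊x⌋₊, cc n * (⌊x / n⌋₊ : ℝ) = ∑ m ∈ Finset.Icc 1 T, (SS cc (x / m) - SS cc (x / T)) := by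
  have hT0 : (0:ℝ) < T := by exact_mod_cast hT
  have h1 : ∀ n ∈ Finset.Ioc ⌊x / T⌋₊ ⌊x⌋₊, cc n * (⌊x / n⌋₊ : ℝ) = ∑ m ∈ Finset.Icc 1 T, if (m:ℝ) ≤ x / n then cc n else 0 := by
    intro n hn
    rw [Finset.mem_Ioc] at hn
    have h2 : x / T < n := (Nat.floor_lt (by positivity)).1 hn.1
    have hn0 : (0:ℝ) < n := lt_of_le_of_lt (by positivity) h2
    rw [floor_sum (T := T) (by positivity), Finset.mul_sum]
    · exact Finset.sum_congr rfl fun m _ => by split_ifs <;> simp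
    · rw [div_le_iff₀ hn0]; rw [div_lt_iff₀ hT0] at h2; linarith
  rw [Finset.sum_congr rfl h1, Finset.sum_comm]
  refine Finset.sum_congr rfl fun m hm => ?_
  rw [Finset.mem_Icc] at hm
  have hm0 : (0:ℝ) < m := by exact_mod_cast hm.1
  have hm1 : (1:ℝ) ≤ m := by exact_mod_cast hm.1
  have hmT : (m:ℝ) ≤ T := by exact_mod_cast hm.2
  rw [SS_sub (by gcongr), ← Finset.sum_filter]
  refine Finset.sum_congr ?_ fun _ _ => rfl
  ext n
  simp only [Finset.mem_filter, Finset.mem_Ioc]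
  have hle : ⌊x / m⌋₊ ≤ ⌊x⌋₊ := Nat.floor_mono (div_le_self hx.le hm1)
  constructor
  · rintro ⟨⟨h2, h3⟩, h4⟩
    refine ⟨h2, ?_⟩
    have hn0 : (0:ℝ) < n := by exact_mod_cast lt_of_le_of_lt (Nat.zero_le _) h2
    rw [Nat.le_floor_iff (by positivity), le_div_iff₀ hm0]
    rw [le_div_iff₀ hn0] at h4; linarith
  · rintro ⟨h2, h3⟩
    refine ⟨⟨h2, h3.trans hle⟩, ?_⟩
    have hn0 : (0:ℝ) < n := by exact_mod_cast lt_of_le_of_lt (Nat.zero_le _) h2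
    rw [Nat.le_floor_iff (by positivity), le_div_iff₀ hm0] at h3
    rw [le_div_iff₀ hn0]; linarith

lemma LL_sub {a b : ℝ} (ha : 2 ≤ a) (hab : a ≤ b) : LL b - LL a = ∫ t in Ioc a b, 1 / Real.log t := by
  rw [LL, LL, intervalIntegral.integral_interval_sub_left (inv_log_ii le_rfl (ha.trans hab)) (inv_log_ii le_rfl ha),
    intervalIntegral.integral_of_le hab]

lemma hyp_int {x : ℝ} {T : ℕ} (hT : 1 ≤ T) (hy : 2 ≤ x / T) :
    IntegrableOn (fun u => (⌊x / u⌋₊ : ℝ) / Real.log u) (Ioc (x / T) x) ∧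
    ∫ u in Ioc (x / T) x, (⌊x / u⌋₊ : ℝ) / Real.log u = ∑ m ∈ Finset.Icc 1 T, (LL (x / m) - LL (x / T)) := by
  have hT0 : (0:ℝ) < T := by exact_mod_cast hT
  have hT1 : (1:ℝ) ≤ T := by exact_mod_cast hT
  have hx : 0 < x := by
    rw [le_div_iff₀ hT0] at hy; linarith
  have hyx : x / T ≤ x := div_le_self hx.le hT1
  have hlog : IntegrableOn (fun t => 1 / Real.log t) (Ioc (x / T) x) := (inv_log_ii hy (hy.trans hyx)).1
  have e : ∀ u ∈ Ioc (x / T) x, (⌊x / u⌋₊ : ℝ) / Real.log u = ∑ m ∈ Finset.Icc 1 T, (Iic (x / m)).indicator (fun t => 1 / Real.log t) u := by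
    intro u hu
    have hu0 : 0 < u := by linarith [hu.1]
    have h2 := hu.1
    rw [floor_sum (T := T) (by positivity), Finset.sum_div]
    · refine Finset.sum_congr rfl fun m hm => ?_
      rw [Finset.mem_Icc] at hm
      have hm0 : (0:ℝ) < m := by exact_mod_cast hm.1
      rw [indicator_apply]
      have : (m:ℝ) ≤ x / u ↔ u ∈ Iic (x / m) := by
        rw [mem_Iic, le_div_iff₀ hu0, le_div_iff₀ hm0, mul_comm]
      simp only [this]
      split_ifs <;> simp
    · rw [div_le_iff₀ hu0]; rw [div_lt_iff₀ hT0] at h2; linarith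
  have hi : ∀ m ∈ Finset.Icc 1 T, IntegrableOn ((Iic (x / m)).indicator (fun t => 1 / Real.log t)) (Ioc (x / T) x) :=
    fun m _ => hlog.indicator measurableSet_Iic
  refine ⟨IntegrableOn.congr_fun (f := fun u => ∑ m ∈ Finset.Icc 1 T, (Iic (x / m)).indicator (fun t => 1 / Real.log t) u) (integrable_finsetSum _ hi) (fun u hu => (e u hu).symm) measurableSet_Ioc, ?_⟩
  rw [setIntegral_congr_fun measurableSet_Ioc e, integral_finsetSum _ hi]
  refine Finset.sum_congr rfl fun m hm => ?_
  rw [Finset.mem_Icc] at hm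
  have hm0 : (0:ℝ) < m := by exact_mod_cast hm.1
  have hm1 : (1:ℝ) ≤ m := by exact_mod_cast hm.1
  have hmT : (m:ℝ) ≤ T := by exact_mod_cast hm.2
  rw [LL_sub hy (by gcongr), setIntegral_indicator measurableSet_Iic]
  congr 2
  ext u
  simp only [mem_inter_iff, mem_Ioc, mem_Iic]
  have : x / m ≤ x := div_le_self hx.le hm1
  constructor
  · rintro ⟨⟨h1, h2⟩, h3⟩; exact ⟨h1, h3⟩
  · rintro ⟨h1, h2⟩; exact ⟨⟨h1, h2.trans this⟩, h2⟩

lemma subst_int {x : ℝ} {T : ℕ} (hT : 1 ≤ T) (hx : 0 < x) :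
    ∫ u in Ioc (x / T) x, (x / u - (⌊x / u⌋₊ : ℝ)) / Real.log u = x * ∫ t in Ioo (1:ℝ) T, (t - (⌊t⌋₊:ℝ)) / (t ^ 2 * (Real.log x - Real.log t)) := by
  have hT0 : (0:ℝ) < T := by exact_mod_cast hT
  have him : (fun t : ℝ => x / t) '' Ioo (1:ℝ) T = Ioo (x / T) x := by
    ext u
    simp only [mem_image, mem_Ioo]
    constructor
    · rintro ⟨t, ⟨h1, h2⟩, rfl⟩
      have h0 : 0 < t := by linarith
      exact ⟨by gcongr, by rw [div_lt_iff₀ h0]; nlinarith⟩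
    · rintro ⟨h1, h2⟩
      have h0 : 0 < u := lt_trans (by positivity) h1
      refine ⟨x / u, ⟨by rw [lt_div_iff₀ h0]; linarith, by rw [div_lt_iff₀ h0]; rw [div_lt_iff₀ hT0] at h1; linarith⟩, by field_simp⟩
  rw [integral_Ioc_eq_integral_Ioo, ← him, integral_image_eq_integral_abs_deriv_smul (f' := fun t => -(x / t^2)) measurableSet_Ioo, ← integral_const_mul]
  · refine setIntegral_congr_fun measurableSet_Ioo fun t ht => ?_
    have h0 : 0 < t := by linarith [ht.1]
    have e1 : x / (x / t) = t := by field_simp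
    rw [e1, abs_neg, abs_of_pos (by positivity), Real.log_div hx.ne' h0.ne', smul_eq_mul, div_mul_div_comm, mul_div_assoc]
  · intro t ht
    have h0 : t ≠ 0 := by linarith [ht.1]
    have := ((hasDerivAt_inv h0).const_mul x).hasDerivWithinAt (s := Ioo (1:ℝ) T)
    refine (this.congr_deriv (by ring)).congr_of_eventuallyEq ?_ ?_
    · exact Eventually.of_forall fun t => by simp [div_eq_mul_inv]
    · simp [div_eq_mul_inv]
  · intro s hs t ht h
    have h0 : 0 < t := by linarith [ht.1]
    have h1 : 0 < s := by linarith [hs.1]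
    have h : x / s = x / t := h
    field_simp at h
    linarith

end

section
open Complex Set Filter Topology MeasureTheory Asymptotics
open scoped ArithmeticFunction.vonMangoldt

lemma SS_cc_le {y : ℝ} (hy : 0 ≤ y) : SS cc y ≤ y := by
  rw [SS, Icc_zero_eq cc cc_zero]
  calc _ ≤ ∑ n ∈ Finset.Icc 1 ⌊y⌋₊, (1:ℝ) := Finset.sum_le_sum fun n _ => cc_le n
    _ = ⌊y⌋₊ := by simp
    _ ≤ y := Nat.floor_le hy

lemma first_part {x y : ℝ} (hx : 0 ≤ x) (hy : 0 ≤ y) : |SS (fun n => cc n * (⌊x / n⌋₊ : ℝ)) y - x * MM y| ≤ y := by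
  have e : SS (fun n => cc n * (⌊x / n⌋₊ : ℝ)) y - x * MM y = - ∑ n ∈ Finset.Icc 0 ⌊y⌋₊, cc n * (x / n - (⌊x / n⌋₊ : ℝ)) := by
    rw [SS, MM, SS, Finset.mul_sum, ← Finset.sum_sub_distrib, ← Finset.sum_neg_distrib]
    exact Finset.sum_congr rfl fun n _ => by ring
  rw [e, abs_neg, abs_of_nonneg]
  · refine le_trans ?_ (SS_cc_le hy)
    rw [SS]
    exact Finset.sum_le_sum fun n _ => mul_le_of_le_one_right (cc_nonneg n) fr_le
  · exact Finset.sum_nonneg fun n _ => mul_nonneg (cc_nonneg n) (fr_nonneg (by positivity))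

theorem CC_asym (N : ℕ) : ∃ C > 0, ∃ x₀ : ℝ, 3 ≤ x₀ ∧ ∀ x ≥ x₀,
    |∑ n ∈ Finset.Icc 1 ⌊x⌋₊, cc n * (⌊x / n⌋₊ : ℝ) - (x * Real.log (Real.log x) + x * DD - x * ∑ j ∈ Finset.Icc 1 N, II j / Real.log x ^ j)|
      ≤ C * x / Real.log x ^ (N+1) := by
  obtain ⟨C1, hC1, H1⟩ := EE_bound (3*N+3)
  obtain ⟨C2, hC2, H2⟩ := MM_asym (N+1)
  obtain ⟨C3, hC3, H3⟩ := frac_exp N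
  have ev : ∀ᶠ x : ℝ in atTop, 4 * Real.log x ^ (4*N+4) ≤ x ∧ 2 ≤ Real.log x ∧ 3 ≤ x := by
    have h1 := (Real.isLittleO_pow_log_id_atTop (n := 4*N+4)).bound (c := 1/4) (by norm_num)
    filter_upwards [h1, Real.tendsto_log_atTop.eventually_ge_atTop 2, eventually_ge_atTop 3] with x h1 h2 h3
    refine ⟨?_, h2, h3⟩
    rw [id, Real.norm_of_nonneg (by positivity), Real.norm_of_nonneg (by linarith)] at h1
    linarith
  obtain ⟨x₁, hx₁⟩ := eventually_atTop.1 ev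
  refine ⟨1 + 4 * C1 * 2 ^ (3*N+3) + C2 * 2 ^ (N+1) + C3, by positivity, max 3 x₁, le_max_left _ _, fun x hx => ?_⟩
  obtain ⟨h1, h2, h3⟩ := hx₁ x ((le_max_right _ _).trans hx)
  set l := Real.log x with hl
  have hx0 : 0 < x := by linarith
  have hl0 : 0 < l := by linarith
  set T := ⌈l ^ (2*N+2)⌉₊ with hTd
  have hT1 : l ^ (2*N+2) ≤ T := Nat.le_ceil _
  have hl1 : 1 ≤ l ^ (2*N+2) := one_le_pow₀ (by linarith)
  have hT2 : (T:ℝ) ≤ 2 * l ^ (2*N+2) := by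
    have := Nat.ceil_lt_add_one (show 0 ≤ l ^ (2*N+2) by positivity)
    linarith
  have hTsq : (T:ℝ)^2 ≤ x := by
    calc (T:ℝ)^2 ≤ (2 * l ^ (2*N+2))^2 := by gcongr
      _ = 4 * l ^ (4*N+4) := by ring
      _ ≤ x := h1
  have hTr1 : (1:ℝ) ≤ T := hl1.trans hT1
  have hTn : 1 ≤ T := by exact_mod_cast hTr1
  have hT0 : (0:ℝ) < T := by linarith
  have hTge : (2:ℝ) ≤ T := by
    have : l ≤ l ^ (2*N+2) := le_self_pow₀ (by linarith) (by omega)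
    linarith
  have hlT : Real.log T ≤ l / 2 := by
    have := Real.log_le_log (by positivity) hTsq
    rw [Real.log_pow] at this
    push_cast at this
    linarith
  have hTT : l ^ (N+1) ≤ (T:ℝ) ^ (1/2:ℝ) := by
    rw [← Real.sqrt_eq_rpow]
    apply Real.le_sqrt_of_sq_le
    calc _ = l ^ (2*N+2) := by ring
      _ ≤ _ := hT1
  set y := x / T with hyd
  have hy2 : 2 ≤ y := by
    rw [hyd, le_div_iff₀ hT0]; nlinarith
  have hy0 : 0 < y := by linarith
  have hyx : y ≤ x := div_le_self hx0.le hTr1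
  have hly : l / 2 ≤ Real.log y := by
    rw [hyd, Real.log_div hx0.ne' hT0.ne']; linarith
  -- first part
  have p1 := first_part hx0.le hy0.le
  have hyle : y ≤ x / l ^ (N+1) := by
    rw [hyd]
    refine div_le_div_of_nonneg_left hx0.le (by positivity) (le_trans ?_ hT1)
    exact pow_le_pow_right₀ (by linarith) (by omega)
  have p1' : |x * MM y - x * (Real.log (Real.log y) + DD)| ≤ C2 * 2 ^ (N+1) * x / l ^ (N+1) := by
    rw [← mul_sub, abs_mul, abs_of_pos hx0, ← sub_sub]
    calc _ ≤ x * (C2 / Real.log y ^ (N+1)) := by gcongr; exact H2 y hy2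
      _ ≤ x * (C2 / (l/2) ^ (N+1)) := by gcongr
      _ = _ := by rw [div_pow]; field_simp
  -- second part
  have p2 := hyp_sum hx0 hTn
  obtain ⟨hi2, p3⟩ := hyp_int hTn hy2
  rw [← hyd] at p2 p3 hi2
  have p4 : |∑ m ∈ Finset.Icc 1 T, (EE (x / m) - EE y)| ≤ 4 * C1 * 2 ^ (3*N+3) * x / l ^ (N+1) := by
    have hE : ∀ z, y ≤ z → z ≤ x → |EE z| ≤ C1 * x / (l/2) ^ (3*N+3) := by
      intro z hz1 hz2
      refine (H1 z (hy2.trans hz1)).trans ?_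
      have : l / 2 ≤ Real.log z := hly.trans (Real.log_le_log hy0 hz1)
      gcongr
    calc _ ≤ ∑ m ∈ Finset.Icc 1 T, |EE (x / m) - EE y| := Finset.abs_sum_le_sum_abs _ _
      _ ≤ ∑ m ∈ Finset.Icc 1 T, 2 * (C1 * x / (l/2) ^ (3*N+3)) := by
        refine Finset.sum_le_sum fun m hm => ?_
        rw [Finset.mem_Icc] at hm
        have hm0 : (0:ℝ) < m := by exact_mod_cast hm.1
        have hm1 : (1:ℝ) ≤ m := by exact_mod_cast hm.1
        have hmT : (m:ℝ) ≤ T := by exact_mod_cast hm.2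
        have a1 := hE (x / m) (by rw [hyd]; gcongr) (div_le_self hx0.le hm1)
        have a2 := hE y le_rfl hyx
        have := abs_sub (EE (x / m)) (EE y)
        linarith
      _ = T * (2 * (C1 * x / (l/2) ^ (3*N+3))) := by simp
      _ ≤ (2 * l ^ (2*N+2)) * (2 * (C1 * x / (l/2) ^ (3*N+3))) := by gcongr
      _ = _ := by
        rw [div_pow, show l ^ (3*N+3) = l ^ (2*N+2) * l ^ (N+1) by ring]; field_simp; try ring
  have p5 : ∑ m ∈ Finset.Icc 1 T, (SS cc (x / m) - SS cc y) = ∑ m ∈ Finset.Icc 1 T, (EE (x / m) - EE y) + ∑ m ∈ Finset.Icc 1 T, (LL (x / m) - LL y) := by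
    rw [← Finset.sum_add_distrib]
    exact Finset.sum_congr rfl fun m _ => by rw [EE, EE]; ring
  have hi1 : IntegrableOn (fun u => x * (1 / (u * Real.log u))) (Ioc y x) := (inv_ulog_ii hy2 (hy2.trans hyx)).1.const_mul x
  have p6 : ∫ u in Ioc y x, (⌊x / u⌋₊ : ℝ) / Real.log u = x * (Real.log l - Real.log (Real.log y)) - ∫ u in Ioc y x, (x / u - (⌊x / u⌋₊ : ℝ)) / Real.log u := by
    rw [hl, ← int_loglog hy2 hyx, intervalIntegral.integral_of_le hyx, ← integral_const_mul]
    have : ∫ u in Ioc y x, (x / u - (⌊x / u⌋₊ : ℝ)) / Real.log u = ∫ u in Ioc y x, (x * (1 / (u * Real.log u)) - (⌊x / u⌋₊ : ℝ) / Real.log u) := by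
      refine setIntegral_congr_fun measurableSet_Ioc fun u hu => ?_
      have h0 : 0 < u := by linarith [hu.1]
      have := log_pos2 (hy2.trans hu.1.le)
      field_simp
    rw [this, integral_sub hi1 hi2]
    ring
  have p7 := subst_int hTn hx0
  have p8 := H3 l T (by linarith) hTr1 hlT hTT
  rw [← hyd, ← hl] at p7
  set J := ∫ t in Ioo (1:ℝ) T, (t - (⌊t⌋₊:ℝ)) / (t ^ 2 * (l - Real.log t))
  have p8' : |x * J - x * ∑ j ∈ Finset.Icc 1 N, II j / l ^ j| ≤ C3 * x / l ^ (N+1) := by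
    rw [← mul_sub, abs_mul, abs_of_pos hx0]
    calc _ ≤ x * (C3 / l ^ (N+1)) := by gcongr
      _ = _ := by ring
  have p9 := SS_sub (a := fun n => cc n * (⌊x / n⌋₊ : ℝ)) hyx
  have p10 : ∑ n ∈ Finset.Icc 1 ⌊x⌋₊, cc n * (⌊x / n⌋₊ : ℝ) = SS (fun n => cc n * (⌊x / n⌋₊ : ℝ)) x := by
    rw [SS, Icc_zero_eq]; simp [cc_zero]
  rw [p10]
  have key : SS (fun n => cc n * (⌊x / n⌋₊ : ℝ)) x - (x * Real.log l + x * DD - x * ∑ j ∈ Finset.Icc 1 N, II j / l ^ j)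
     = (SS (fun n => cc n * (⌊x / n⌋₊ : ℝ)) y - x * MM y) + (x * MM y - x * (Real.log (Real.log y) + DD))
       + ∑ m ∈ Finset.Icc 1 T, (EE (x / m) - EE y) - (x * J - x * ∑ j ∈ Finset.Icc 1 N, II j / l ^ j) := by
    linarith
  rw [key]
  set q := x / l ^ (N+1) with hq
  rw [mul_div_assoc, ← hq] at p1' p4 p8' ⊢
  rw [abs_le] at *
  constructor <;> linarith [p1.1, p1.2, p1'.1, p1'.2, p4.1, p4.2, p8'.1, p8'.2]

end

section
open Complex Set Filter Topology MeasureTheory Asymptotics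
open scoped ArithmeticFunction.vonMangoldt

lemma logexp_int : IntegrableOn (fun w : ℝ => |Real.log w| * Real.exp (-w)) (Ioi 0) := by
  have h1 := (Real.GammaIntegral_convergent (s := 1/2) (by norm_num)).const_mul 2
  have h2 := (Real.GammaIntegral_convergent (s := 2) (by norm_num))
  refine (h1.add h2).mono' ?_ ?_
  · exact ((continuous_abs.measurable.comp Real.measurable_log).mul (Real.continuous_exp.measurable.comp measurable_neg)).aestronglyMeasurable
  rw [ae_restrict_iff' measurableSet_Ioi]
  refine Eventually.of_forall fun w hw => ?_
  have hw : 0 < w := hw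
  rw [Real.norm_of_nonneg (by positivity)]
  have e : |Real.log w| ≤ 2 * w ^ ((1/2:ℝ) - 1) + w ^ ((2:ℝ) - 1) := by
    have a1 : Real.log w ≤ w ^ ((2:ℝ) - 1) := by
      norm_num; linarith [Real.log_le_sub_one_of_pos hw]
    have a2 : - Real.log w ≤ 2 * w ^ ((1/2:ℝ) - 1) := by
      have := Real.log_le_rpow_div (x := w⁻¹) (by positivity) (ε := 1/2) (by norm_num)
      rw [Real.log_inv, Real.inv_rpow hw.le, ← Real.rpow_neg hw.le] at this
      norm_num at this ⊢
      linarith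
    have a3 : 0 ≤ w ^ ((2:ℝ) - 1) := by positivity
    have a4 : 0 ≤ 2 * w ^ ((1/2:ℝ) - 1) := by positivity
    generalize w ^ ((2:ℝ) - 1) = A at *
    generalize w ^ ((1/2:ℝ) - 1) = B at *
    rw [abs_le]; constructor <;> linarith
  calc _ ≤ (2 * w ^ ((1/2:ℝ) - 1) + w ^ ((2:ℝ) - 1)) * Real.exp (-w) := by gcongr
    _ = _ := by simp only [Pi.add_apply]; ring

lemma logexp_int' : IntegrableOn (fun w : ℝ => Real.log w * Real.exp (-w)) (Ioi 0) := by
  refine logexp_int.mono' ?_ ?_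
  · exact (Real.measurable_log.mul (Real.continuous_exp.measurable.comp measurable_neg)).aestronglyMeasurable
  · exact Eventually.of_forall fun w => by rw [norm_mul, Real.norm_eq_abs, Real.norm_of_nonneg (Real.exp_nonneg _)]

lemma logexp_val : ∫ w in Ioi (0:ℝ), Real.log w * Real.exp (-w) = - Real.eulerMascheroniConstant := by
  have h1 := hasDerivAt_GammaIntegral (s := 1) (by simp)
  have h2 := Complex.hasDerivAt_Gamma_one
  have h3 : Complex.GammaIntegral =ᶠ[𝓝 1] Complex.Gamma := by
    have : {s : ℂ | 0 < s.re} ∈ 𝓝 (1:ℂ) := (isOpen_lt continuous_const continuous_re).mem_nhds (by simp)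
    filter_upwards [this] with s hs using (Complex.Gamma_eq_integral hs).symm
  have h4 := (h2.congr_of_eventuallyEq h3).unique h1
  have h5 : ∫ t : ℝ in Ioi 0, (t:ℂ) ^ ((1:ℂ) - 1) * (Real.log t * Real.exp (-t) : ℂ) = ((∫ w in Ioi (0:ℝ), Real.log w * Real.exp (-w) : ℝ) : ℂ) := by
    rw [← integral_complex_ofReal]
    refine setIntegral_congr_fun measurableSet_Ioi fun t _ => by simp
  rw [h5] at h4
  exact_mod_cast h4.symm

lemma MM_nonneg (y : ℝ) : 0 ≤ MM y := by
  rw [MM, SS]; exact Finset.sum_nonneg fun n _ => div_nonneg (cc_nonneg n) (Nat.cast_nonneg n)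

lemma MM_one {y : ℝ} (hy : y < 2) : MM y = 0 := by
  rw [MM, SS]
  refine Finset.sum_eq_zero fun n hn => ?_
  rw [Finset.mem_Icc] at hn
  have : ⌊y⌋₊ < 2 := by
    apply (Nat.floor_lt' (by norm_num)).2; exact_mod_cast hy
  obtain h | h : n = 0 ∨ n = 1 := by omega
  · simp [h]
  · simp [h, cc_one]

lemma MM_meas : Measurable MM := SS_meas _

lemma zeta_MM {δ : ℝ} (hδ : 0 < δ) :
    Real.log (riemannZeta ((1 + δ : ℝ) : ℂ)).re = δ * ∫ t in Ioi (1:ℝ), MM t * t ^ (-(δ + 1)) := by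
  rw [log_riemannZeta_eq (by linarith)]
  have hO : (fun n : ℕ ↦ ∑ k ∈ Finset.Icc 1 n, cc k / k) =O[atTop] fun n ↦ (n : ℝ) ^ (δ/2) := by
    have hlog : (fun n : ℕ => Real.log n) =O[atTop] fun n : ℕ ↦ (n : ℝ) ^ (δ/2) :=
      ((isLittleO_log_rpow_atTop (by positivity : 0 < δ/2)).comp_tendsto tendsto_natCast_atTop_atTop).isBigO
    have hone : (fun n : ℕ => (1:ℝ)) =O[atTop] fun n : ℕ ↦ (n : ℝ) ^ (δ/2) := by
      refine IsBigO.of_bound 1 ?_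
      filter_upwards [eventually_ge_atTop 1] with n hn
      have : (1:ℝ) ≤ n := by exact_mod_cast hn
      rw [norm_one, one_mul, Real.norm_of_nonneg (by positivity)]
      exact Real.one_le_rpow this (by positivity)
    obtain ⟨C, hC, H⟩ := MM_asym 0
    refine IsBigO.trans ?_ (hlog.add (hone.const_mul_left (|DD| + C)))
    refine IsBigO.of_bound 1 ?_
    filter_upwards [eventually_ge_atTop 3] with n hn
    have hn' : (3:ℝ) ≤ n := by exact_mod_cast hn
    have e : ∑ k ∈ Finset.Icc 1 n, cc k / k = MM n := by
      rw [MM, SS, Icc_zero_eq _ (by simp [cc_zero]), Nat.floor_natCast]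
    have h := H n (by linarith)
    rw [pow_zero, div_one, abs_le] at h
    have hl : 0 < Real.log n := log_pos2 (by linarith)
    have h2 := Real.log_le_sub_one_of_pos hl
    have h3 := le_abs_self DD
    have h4 := abs_nonneg DD
    rw [e, Real.norm_of_nonneg (MM_nonneg _), Real.norm_of_nonneg (by positivity)]
    linarith [h.2]
  have hL := LSeries_eq_mul_integral_of_nonneg (fun n => cc n / n) (r := δ/2) (by positivity) (s := (δ:ℂ)) (by simp; linarith) hO
    (fun n => div_nonneg (cc_nonneg n) (Nat.cast_nonneg n))
  apply Complex.ofReal_injective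
  have e1 : LSeries (fun n => ((cc n / n : ℝ) : ℂ)) δ = ((∑' n : ℕ, Λ n / ((n:ℝ) ^ (1 + δ) * Real.log n) : ℝ) : ℂ) := by
    rw [LSeries_def₀ (by simp), Complex.ofReal_tsum]
    refine tsum_congr fun n => ?_
    rcases Nat.eq_zero_or_pos n with h | h
    · simp [h]
    have hn : (0:ℝ) < n := by exact_mod_cast h
    rw [cc, Real.rpow_add hn, Real.rpow_one]
    push_cast
    rw [ofReal_cpow hn.le]
    push_cast
    rw [div_div, div_div]
    ring_nf
  rw [← e1, hL]
  push_cast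
  rw [← integral_complex_ofReal]
  congr 1
  refine setIntegral_congr_fun measurableSet_Ioi fun t ht => ?_
  have ht : (1:ℝ) < t := ht
  have e : ∑ k ∈ Finset.Icc 1 ⌊t⌋₊, cc k / k = MM t := by
    rw [MM, SS, Icc_zero_eq _ (by simp [cc_zero])]
  rw [← e]
  push_cast
  rw [ofReal_cpow (by linarith)]
  push_cast
  rfl

lemma zeta_MM2 {δ : ℝ} (hδ : 0 < δ) :
    Real.log (riemannZeta ((1 + δ : ℝ) : ℂ)).re = ∫ w in Ioi (0:ℝ), MM (Real.exp (w / δ)) * Real.exp (-w) := by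
  rw [zeta_MM hδ, ← Real.exp_zero, ← integral_comp_exp_Ioi]
  have h := integral_comp_mul_left_Ioi' (fun w => MM (Real.exp (w / δ)) * Real.exp (-w)) 0 hδ
  rw [mul_zero, smul_eq_mul] at h
  rw [Real.exp_zero, ← h]
  congr 1
  refine setIntegral_congr_fun measurableSet_Ioi fun v _ => ?_
  simp only [smul_eq_mul]
  rw [mul_div_cancel_left₀ _ hδ.ne', ← Real.exp_mul, mul_left_comm, ← Real.exp_add]
  congr 2; ring

noncomputable def rr (v : ℝ) : ℝ := MM (Real.exp v) - Real.log v - DD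

lemma rr_bound : ∃ K > 0, ∀ δ w : ℝ, 0 < δ → δ ≤ 1 → 0 < w → |rr (w / δ)| ≤ K + |Real.log w| := by
  obtain ⟨C, hC, H⟩ := MM_asym 0
  refine ⟨C + |DD|, by positivity, fun δ w h0 h1 hw => ?_⟩
  have hv : w ≤ w / δ := by rw [le_div_iff₀ h0]; nlinarith
  have hv0 : 0 < w / δ := by positivity
  rw [rr]
  by_cases h2 : 2 ≤ Real.exp (w / δ)
  · have := H _ h2
    rw [Real.log_exp, pow_zero, div_one] at this
    have a := abs_nonneg DD
    have b := abs_nonneg (Real.log w)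
    linarith
  · push Not at h2
    rw [MM_one h2, zero_sub]
    have hlt : w / δ < 1 := by
      have := Real.add_one_le_exp (w / δ); linarith
    have hl : |Real.log (w / δ)| ≤ |Real.log w| := by
      rw [abs_of_nonpos (Real.log_nonpos hv0.le hlt.le), abs_of_nonpos (Real.log_nonpos hw.le (by linarith))]
      have := Real.log_le_log hw hv
      linarith
    calc _ ≤ |-Real.log (w / δ)| + |DD| := abs_sub _ _
      _ ≤ _ := by rw [abs_neg]; linarith

lemma rr_tendsto : Tendsto rr atTop (𝓝 0) := by
  obtain ⟨C, hC, H⟩ := MM_asym 1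
  have h1 : Tendsto (fun v : ℝ => C / v) atTop (𝓝 0) := tendsto_const_nhds.div_atTop tendsto_id
  refine squeeze_zero_norm' ?_ h1
  filter_upwards [eventually_ge_atTop 1] with v hv
  have := H (Real.exp v) (by linarith [Real.add_one_le_exp v])
  rwa [Real.log_exp, pow_one] at this

lemma rr_meas : Measurable rr :=
  ((MM_meas.comp Real.measurable_exp).sub Real.measurable_log).sub measurable_const

lemma exp_neg_int : IntegrableOn (fun w : ℝ => Real.exp (-w)) (Ioi 0) := integrableOn_exp_neg_Ioi 0

theorem DD_eq : DD = Real.eulerMascheroniConstant := by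
  obtain ⟨K, hK, hr⟩ := rr_bound
  have hdom : IntegrableOn (fun w : ℝ => (K + |Real.log w|) * Real.exp (-w)) (Ioi 0) := by
    refine IntegrableOn.congr_fun (f := (fun w : ℝ => K * Real.exp (-w)) + (fun w => |Real.log w| * Real.exp (-w))) ((exp_neg_int.const_mul K).add logexp_int) (fun w _ => ?_) measurableSet_Ioi
    simp only [Pi.add_apply]; ring
  have hm : ∀ δ : ℝ, AEStronglyMeasurable (fun w : ℝ => rr (w / δ) * Real.exp (-w)) (volume.restrict (Ioi 0)) := fun δ =>
    ((rr_meas.comp (measurable_id.div_const δ)).mul (Real.continuous_exp.measurable.comp measurable_neg)).aestronglyMeasurable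
  have hb : ∀ δ : ℝ, 0 < δ → δ ≤ 1 → ∀ᵐ w ∂(volume.restrict (Ioi (0:ℝ))), ‖rr (w / δ) * Real.exp (-w)‖ ≤ (K + |Real.log w|) * Real.exp (-w) := by
    intro δ h0 h1
    rw [ae_restrict_iff' measurableSet_Ioi]
    refine Eventually.of_forall fun w hw => ?_
    rw [norm_mul, Real.norm_eq_abs, Real.norm_of_nonneg (Real.exp_nonneg _)]
    gcongr
    exact hr δ w h0 h1 hw
  have hev : ∀ᶠ δ : ℝ in 𝓝[>] 0, 0 < δ ∧ δ ≤ 1 := by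
    filter_upwards [Ioc_mem_nhdsGT (one_pos : (0:ℝ) < 1)] with δ h using h
  have hlim : Tendsto (fun δ : ℝ => ∫ w in Ioi (0:ℝ), rr (w / δ) * Real.exp (-w)) (𝓝[>] 0) (𝓝 (∫ w in Ioi (0:ℝ), 0)) := by
    refine tendsto_integral_filter_of_dominated_convergence (fun w : ℝ => (K + |Real.log w|) * Real.exp (-w)) (Eventually.of_forall hm) ?_ hdom ?_
    · filter_upwards [hev] with δ h using hb δ h.1 h.2
    · rw [ae_restrict_iff' measurableSet_Ioi]
      refine Eventually.of_forall fun w hw => ?_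
      have hw : 0 < w := hw
      have h1 : Tendsto (fun δ : ℝ => w / δ) (𝓝[>] 0) atTop := by
        simp only [div_eq_mul_inv]
        exact tendsto_inv_nhdsGT_zero.const_mul_atTop hw
      simpa using (rr_tendsto.comp h1).mul_const (Real.exp (-w))
  rw [integral_zero] at hlim
  have hz : Tendsto (fun δ : ℝ => Real.log (riemannZeta ((1 + δ : ℝ) : ℂ)).re + Real.log δ) (𝓝[>] 0) (𝓝 0) := by
    have h := (isLittleO_one_iff ℝ).1 log_riemannZeta_add_log_sub_isLittleO_ofReal
    have h2 : Tendsto (fun δ : ℝ => 1 + δ) (𝓝[>] 0) (𝓝[>] 1) := by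
      refine tendsto_nhdsWithin_iff.2 ⟨?_, ?_⟩
      · have : Tendsto (fun δ : ℝ => 1 + δ) (𝓝 0) (𝓝 (1 + 0)) := (continuous_const.add continuous_id).tendsto 0
        rw [add_zero] at this
        exact this.mono_left nhdsWithin_le_nhds
      · filter_upwards [hev] with δ h; simp [h.1]
    refine (h.comp h2).congr fun δ => ?_
    simp
  have heq : ∀ᶠ δ : ℝ in 𝓝[>] 0, Real.log (riemannZeta ((1 + δ : ℝ) : ℂ)).re + Real.log δ = (- Real.eulerMascheroniConstant + DD) + ∫ w in Ioi (0:ℝ), rr (w / δ) * Real.exp (-w) := by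
    filter_upwards [hev] with δ h
    have hi : IntegrableOn (fun w : ℝ => rr (w / δ) * Real.exp (-w)) (Ioi 0) := hdom.mono' (hm δ) (hb δ h.1 h.2)
    have e : ∫ w in Ioi (0:ℝ), MM (Real.exp (w / δ)) * Real.exp (-w) = ∫ w in Ioi (0:ℝ), (Real.log w * Real.exp (-w) + (DD - Real.log δ) * Real.exp (-w) + rr (w / δ) * Real.exp (-w)) := by
      refine setIntegral_congr_fun measurableSet_Ioi fun w hw => ?_
      have hw : 0 < w := hw
      simp only [rr, Real.log_div hw.ne' h.1.ne']
      ring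
    have i1 : IntegrableOn (fun w : ℝ => (DD - Real.log δ) * Real.exp (-w)) (Ioi 0) := exp_neg_int.const_mul _
    have i2 : IntegrableOn (fun w : ℝ => Real.log w * Real.exp (-w) + (DD - Real.log δ) * Real.exp (-w)) (Ioi 0) := logexp_int'.add i1
    rw [zeta_MM2 h.1, e, integral_add i2 hi, integral_add logexp_int' i1, logexp_val, integral_const_mul, integral_exp_neg_Ioi_zero]
    ring
  have h1 := hz.congr' heq
  have h2 := tendsto_nhds_unique h1 (hlim.const_add _)
  linarith

end

section
open Complex Set Filter Topology MeasureTheory Asymptotics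
open scoped ArithmeticFunction.vonMangoldt

open Classical in
noncomputable def dd (f : ℕ → ℂ) (q : ℕ) : ℂ := if IsPrimePow q then f q - f (q / q.minFac) else 0

noncomputable def ee (f : ℕ → ℂ) (q : ℕ) : ℂ := dd f q - (cc q : ℂ)

lemma f_one {f : ℕ → ℂ} (hadd : ∀ m n : ℕ, Nat.Coprime m n → f (m * n) = f m + f n) : f 1 = 0 := by
  have := hadd 1 1 (by simp)
  simpa using this

lemma dd_pp (f : ℕ → ℂ) {p : ℕ} (hp : p.Prime) (k : ℕ) : dd f (p ^ (k+1)) = f (p ^ (k+1)) - f (p ^ k) := by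
  rw [dd, if_pos (hp.isPrimePow.pow k.succ_ne_zero), hp.pow_minFac k.succ_ne_zero, pow_succ, Nat.mul_div_cancel _ hp.pos]

lemma dd_of_not (f : ℕ → ℂ) {q : ℕ} (h : ¬ IsPrimePow q) : dd f q = 0 := if_neg h

lemma cc_pp {p : ℕ} (hp : p.Prime) (k : ℕ) : cc (p ^ (k+1)) = 1 / (k + 1) := by
  have hl : 0 < Real.log p := Real.log_pos (by exact_mod_cast hp.one_lt)
  rw [cc, ArithmeticFunction.vonMangoldt_apply_pow k.succ_ne_zero, ArithmeticFunction.vonMangoldt_apply_prime hp]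
  push_cast
  rw [Real.log_pow]
  push_cast
  field_simp

lemma cc_of_not {q : ℕ} (h : ¬ IsPrimePow q) : cc q = 0 := by
  rw [cc, ArithmeticFunction.vonMangoldt_eq_zero_iff.2 h, zero_div]

lemma ee_of_not (f : ℕ → ℂ) {q : ℕ} (h : ¬ IsPrimePow q) : ee f q = 0 := by
  rw [ee, dd_of_not f h, cc_of_not h]; simp

lemma ee_pp (f : ℕ → ℂ) {p : ℕ} (hp : p.Prime) (k : ℕ) : ee f (p ^ (k+1)) = f (p ^ (k+1)) - f (p ^ k) - 1 / ((k:ℂ) + 1) := by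
  rw [ee, dd_pp f hp, cc_pp hp]; push_cast; rfl

lemma f_eq_sum {f : ℕ → ℂ} (hadd : ∀ m n : ℕ, Nat.Coprime m n → f (m * n) = f m + f n) (n : ℕ) :
    n ≠ 0 → f n = ∑ q ∈ n.divisors, dd f q := by
  classical
  induction n using Nat.recOnPosPrimePosCoprime with
  | zero => intro h; exact absurd rfl h
  | one => intro _; simp [f_one hadd, dd_of_not f not_isPrimePow_one]
  | prime_pow p k hp hk =>
    intro _
    rw [Nat.sum_divisors_prime_pow hp, Finset.sum_range_succ', pow_zero, dd_of_not f not_isPrimePow_one, add_zero]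
    simp only [dd_pp f hp]
    rw [Finset.sum_range_sub (fun i => f (p ^ i)), pow_zero, f_one hadd, sub_zero]
  | coprime a b ha hb hab ha' hb' =>
    intro _
    rw [hadd a b hab, ha' (by omega), hb' (by omega)]
    have key : ∀ n : ℕ, ∑ q ∈ n.divisors, dd f q = ∑ q ∈ n.divisors with IsPrimePow q, dd f q := by
      intro n
      rw [Finset.sum_filter]
      refine Finset.sum_congr rfl fun q _ => ?_
      split_ifs with h
      · rfl
      · exact dd_of_not f h
    rw [key a, key b, key (a * b), Nat.mul_divisors_filter_prime_pow hab, Finset.filter_union,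
      Finset.sum_union (Nat.disjoint_divisors_filter_isPrimePow hab)]

noncomputable def ddA (f : ℕ → ℂ) : ArithmeticFunction ℂ := ⟨dd f, dd_of_not f not_isPrimePow_zero⟩

lemma sum_f {f : ℕ → ℂ} (hadd : ∀ m n : ℕ, Nat.Coprime m n → f (m * n) = f m + f n) (x : ℝ) :
    ∑ n ∈ Finset.Icc 1 ⌊x⌋₊, f n = ∑ q ∈ Finset.Icc 1 ⌊x⌋₊, dd f q * (⌊x / q⌋₊ : ℂ) := by
  have h := ArithmeticFunction.sum_Ioc_mul_zeta_eq_sum (ddA f) ⌊x⌋₊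
  have e : Finset.Ioc 0 ⌊x⌋₊ = Finset.Icc 1 ⌊x⌋₊ := by ext; simp [Nat.lt_iff_add_one_le]
  rw [e] at h
  calc _ = ∑ n ∈ Finset.Icc 1 ⌊x⌋₊, (ddA f * (ArithmeticFunction.zeta : ArithmeticFunction ℂ)) n := by
        refine Finset.sum_congr rfl fun n hn => ?_
        rw [Finset.mem_Icc] at hn
        rw [ArithmeticFunction.coe_mul_zeta_apply, f_eq_sum hadd n (by omega)]; rfl
    _ = _ := by
      rw [h]
      refine Finset.sum_congr rfl fun n hn => ?_
      rw [Nat.floor_div_natCast]; rfl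

lemma f_bd {f : ℕ → ℂ} (hp1 : ∀ p : ℕ, p.Prime → f p = 1) {l : ℕ} {K : ℝ} (h : ∀ p : ℕ, p.Prime → ∀ ν : ℕ, 2 ≤ ν → ‖f (p ^ ν)‖ ≤ K * (ν : ℝ) ^ l)
    {p : ℕ} (hp : p.Prime) (k : ℕ) : ‖f (p ^ (k+1))‖ ≤ (|K| + 1) * ((k:ℝ)+1) ^ l := by
  have h1 : (1:ℝ) ≤ ((k:ℝ)+1)^l := one_le_pow₀ (by linarith [Nat.cast_nonneg (α := ℝ) k])
  rcases Nat.eq_zero_or_pos k with hk | hk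
  · rw [hk, zero_add, pow_one, hp1 p hp, norm_one]
    rw [hk] at h1
    nlinarith [abs_nonneg K]
  · have := h p hp (k+1) (by omega)
    push_cast at this
    nlinarith [le_abs_self K]

lemma ee_bd {f : ℕ → ℂ} (hadd : ∀ m n : ℕ, Nat.Coprime m n → f (m * n) = f m + f n) (hp1 : ∀ p : ℕ, p.Prime → f p = 1) {l : ℕ} {K : ℝ} (h : ∀ p : ℕ, p.Prime → ∀ ν : ℕ, 2 ≤ ν → ‖f (p ^ ν)‖ ≤ K * (ν : ℝ) ^ l)
    {p : ℕ} (hp : p.Prime) (k : ℕ) : ‖ee f (p ^ (k+1))‖ ≤ if k = 0 then 0 else (2 * |K| + 3) * ((k:ℝ)+1) ^ l := by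
  rw [ee_pp f hp]
  split_ifs with hk
  · simp [hk, hp1 p hp, f_one hadd]
  · obtain ⟨m, rfl⟩ := Nat.exists_eq_succ_of_ne_zero hk
    have h1 := f_bd hp1 h hp (m+1)
    have h2 := f_bd hp1 h hp m
    have h3 : ((m:ℝ)+1)^l ≤ (((m+1:ℕ):ℝ)+1)^l := by
      push_cast; gcongr; linarith
    have h4 : (1:ℝ) ≤ (((m+1:ℕ):ℝ)+1)^l := one_le_pow₀ (by push_cast; linarith [Nat.cast_nonneg (α := ℝ) m])
    have h5 : ‖(1:ℂ) / (((m+1:ℕ):ℂ)+1)‖ ≤ 1 := by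
      rw [norm_div, norm_one]
      have : (((m+1:ℕ):ℂ)+1) = ((m+2:ℕ):ℂ) := by push_cast; ring
      rw [this, Complex.norm_natCast, div_le_one (by positivity)]
      push_cast; linarith [Nat.cast_nonneg (α := ℝ) m]
    have h6 : (|K|+1) * ((m:ℝ)+1)^l ≤ (|K|+1) * (((m+1:ℕ):ℝ)+1)^l := by gcongr
    calc _ ≤ ‖f (p ^ (m+1+1))‖ + ‖f (p ^ (m+1))‖ + ‖(1:ℂ) / (((m+1:ℕ):ℂ)+1)‖ := by
          refine (norm_sub_le _ _).trans ?_
          gcongr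
          exact norm_sub_le _ _
      _ ≤ _ := by
        have e : Nat.succ m = m + 1 := rfl
        rw [e]
        linarith

lemma ee_pair_summable {f : ℕ → ℂ} (hadd : ∀ m n : ℕ, Nat.Coprime m n → f (m * n) = f m + f n) (hp1 : ∀ p : ℕ, p.Prime → f p = 1) {l : ℕ} {K : ℝ} (h : ∀ p : ℕ, p.Prime → ∀ ν : ℕ, 2 ≤ ν → ‖f (p ^ ν)‖ ≤ K * (ν : ℝ) ^ l) :
    Summable (fun z : Nat.Primes × ℕ => ‖ee f ((z.1:ℕ) ^ (z.2+1))‖ * (((z.1:ℕ) ^ (z.2+1) : ℕ) : ℝ) ^ (-(3/4) : ℝ)) := by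
  set r : ℝ := (2:ℝ) ^ (-(3/4) : ℝ) with hr
  have hr0 : 0 < r := by positivity
  have hr1 : r < 1 := Real.rpow_lt_one_of_one_lt_of_neg (by norm_num) (by norm_num)
  have s1 : Summable (fun k : ℕ => ((k:ℝ)+1)^l * r ^ (k+1)) := by
    have := summable_pow_mul_geometric_of_norm_lt_one l (r := r) (by rwa [Real.norm_of_nonneg hr0.le])
    have := (summable_nat_add_iff 1).2 this
    simpa using this
  have s2 : Summable (fun p : Nat.Primes => ((p:ℕ):ℝ) ^ (-(3/2):ℝ)) := Nat.Primes.summable_rpow.2 (by norm_num)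
  have s3 := (s2.mul_of_nonneg s1 (fun p => by positivity) (fun k => by positivity)).mul_left ((2 * |K| + 3) * (r^2)⁻¹)
  refine Summable.of_nonneg_of_le (fun z => by positivity) ?_ s3
  rintro ⟨p, k⟩
  have hp := p.2
  have h1 := ee_bd hadd hp1 h hp k
  have hp2 : (2:ℝ) ≤ ((p:ℕ):ℝ) := by exact_mod_cast hp.two_le
  simp only
  split_ifs at h1 with hk
  · have : ‖ee f ((p:ℕ) ^ (k+1))‖ = 0 := le_antisymm h1 (norm_nonneg _)
    rw [this, zero_mul]; positivity
  · obtain ⟨m, rfl⟩ := Nat.exists_eq_succ_of_ne_zero hk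
    set t : ℝ := ((p:ℕ):ℝ) ^ (-(3/4):ℝ) with ht
    have ht0 : 0 ≤ t := by positivity
    have htr : t ≤ r := Real.rpow_le_rpow_of_nonpos (by norm_num) hp2 (by norm_num)
    have e1 : (((p:ℕ) ^ (Nat.succ m+1) : ℕ) : ℝ) ^ (-(3/4) : ℝ) = t ^ 2 * t ^ m := by
      push_cast
      rw [← Real.rpow_natCast, ← Real.rpow_mul (by positivity), mul_comm, Real.rpow_mul (by positivity), Real.rpow_natCast, ← ht, ← pow_add]
      congr 1; simp only [Nat.succ_eq_add_one]; ring
    have e2 : ((p:ℕ):ℝ) ^ (-(3/2):ℝ) = t ^ 2 := by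
      rw [ht, ← Real.rpow_natCast, ← Real.rpow_mul (by positivity)]; norm_num
    rw [e1, e2]
    calc _ ≤ ((2 * |K| + 3) * (((Nat.succ m : ℕ):ℝ)+1) ^ l) * (t ^ 2 * r ^ m) := by gcongr
      _ = _ := by
        rw [show Nat.succ m + 1 = m + 2 from rfl, pow_add r m 2]; field_simp

lemma ee_summable {f : ℕ → ℂ} (hadd : ∀ m n : ℕ, Nat.Coprime m n → f (m * n) = f m + f n) (hp1 : ∀ p : ℕ, p.Prime → f p = 1) {l : ℕ} {K : ℝ} (h : ∀ p : ℕ, p.Prime → ∀ ν : ℕ, 2 ≤ ν → ‖f (p ^ ν)‖ ≤ K * (ν : ℝ) ^ l) :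
    Summable (fun q : ℕ => ‖ee f q‖ * (q : ℝ) ^ (-(3/4) : ℝ)) := by
  have hinj : Function.Injective (fun z : Nat.Primes × ℕ => (z.1:ℕ) ^ (z.2+1)) :=
    Subtype.val_injective.comp Nat.Primes.prodNatEquiv.injective
  refine (hinj.summable_iff ?_).1 (ee_pair_summable hadd hp1 h)
  intro q hq
  have : ¬ IsPrimePow q := by
    intro hpp
    apply hq
    refine ⟨Nat.Primes.prodNatEquiv.symm ⟨q, hpp⟩, ?_⟩
    exact congrArg Subtype.val (Nat.Primes.prodNatEquiv.apply_symm_apply ⟨q, hpp⟩)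
  rw [ee_of_not f this]; simp

lemma fr_le_rpow {v : ℝ} (hv : 0 ≤ v) : v - (⌊v⌋₊:ℝ) ≤ v ^ (3/4:ℝ) := by
  by_cases h : v ≤ 1
  · have h1 : v ≤ v ^ (3/4:ℝ) := by
      nth_rw 1 [← Real.rpow_one v]
      rcases hv.eq_or_lt with h0 | h0
      · rw [← h0, Real.zero_rpow (by norm_num), Real.zero_rpow (by norm_num)]
      · exact Real.rpow_le_rpow_of_exponent_ge h0 h (by norm_num)
    have : (0:ℝ) ≤ ⌊v⌋₊ := by positivity
    linarith
  · push Not at h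
    exact fr_le.trans (Real.one_le_rpow h.le (by norm_num))

lemma ee_norm_summable {f : ℕ → ℂ} (hs : Summable (fun q : ℕ => ‖ee f q‖ * (q : ℝ) ^ (-(3/4) : ℝ))) :
    Summable (fun q : ℕ => ‖ee f q / q‖) := by
  refine Summable.of_nonneg_of_le (fun _ => norm_nonneg _) (fun q => ?_) hs
  rw [norm_div, Complex.norm_natCast, div_eq_mul_inv]
  rcases Nat.eq_zero_or_pos q with h | h
  · simp [h]
  have : (1:ℝ) ≤ q := by exact_mod_cast h
  gcongr
  rw [← Real.rpow_neg_one]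
  exact Real.rpow_le_rpow_of_exponent_le this (by norm_num)

lemma ee_sum_asym {f : ℕ → ℂ} (hs : Summable (fun q : ℕ => ‖ee f q‖ * (q : ℝ) ^ (-(3/4) : ℝ))) {x : ℝ} (hx : 0 < x) :
    ‖∑ q ∈ Finset.Icc 1 ⌊x⌋₊, ee f q * (⌊x / q⌋₊ : ℂ) - x * ∑' q : ℕ, ee f q / q‖ ≤ x ^ (3/4:ℝ) * ∑' q : ℕ, ‖ee f q‖ * (q : ℝ) ^ (-(3/4) : ℝ) := by
  have h0 : ee f 0 = 0 := ee_of_not f not_isPrimePow_zero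
  have hz : ∀ q ∉ Finset.Icc 1 ⌊x⌋₊, ee f q * (⌊x / q⌋₊ : ℂ) = 0 := by
    intro q hq
    rw [Finset.mem_Icc] at hq
    rcases Nat.eq_zero_or_pos q with h | h
    · simp [h]
    have : ⌊x⌋₊ < q := by omega
    rw [Nat.floor_div_natCast, Nat.div_eq_of_lt this]; simp
  have s1 := (ee_norm_summable hs).of_norm
  have e0 : ∑' q : ℕ, ee f q * (⌊x / q⌋₊ : ℂ) = ∑ q ∈ Finset.Icc 1 ⌊x⌋₊, ee f q * (⌊x / q⌋₊ : ℂ) := tsum_eq_sum hz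
  rw [← e0, ← tsum_mul_left, ← Summable.tsum_sub (summable_of_ne_finset_zero hz) (s1.mul_left _), ← tsum_mul_left]
  refine tsum_of_norm_bounded (hs.mul_left _).hasSum fun q => ?_
  have e : ee f q * (⌊x / q⌋₊ : ℂ) - x * (ee f q / q) = - (ee f q * ((x / q - (⌊x / q⌋₊ : ℝ) : ℝ) : ℂ)) := by
    push_cast; ring
  rw [e, norm_neg, norm_mul, Complex.norm_real]
  have hv : 0 ≤ x / q := by positivity
  rw [Real.norm_of_nonneg (fr_nonneg hv), mul_left_comm]
  refine mul_le_mul_of_nonneg_left ((fr_le_rpow hv).trans (le_of_eq ?_)) (norm_nonneg _)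
  rw [Real.div_rpow hx.le (by positivity), Real.rpow_neg (by positivity), div_eq_mul_inv]

lemma ee_inner {f : ℕ → ℂ} (hadd : ∀ m n : ℕ, Nat.Coprime m n → f (m * n) = f m + f n) (hp1 : ∀ p : ℕ, p.Prime → f p = 1) {l : ℕ} {K : ℝ} (h : ∀ p : ℕ, p.Prime → ∀ ν : ℕ, 2 ≤ ν → ‖f (p ^ ν)‖ ≤ K * (ν : ℝ) ^ l)
    {p : ℕ} (hp : p.Prime) :
    ∑' k : ℕ, ee f (p ^ (k+1)) / ((p ^ (k+1) : ℕ) : ℂ) = (Real.log (1 - 1 / (p : ℝ)) : ℂ) + (1 - 1 / (p : ℂ)) * ∑' ν : ℕ, f (p ^ (ν + 1)) / (p : ℂ) ^ (ν + 1) := by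
  have hp2 : (2:ℝ) ≤ p := by exact_mod_cast hp.two_le
  have hp0 : (p:ℂ) ≠ 0 := by exact_mod_cast hp.ne_zero
  set F : ℕ → ℂ := fun k => f (p ^ k) / (p:ℂ) ^ k with hF
  have hx : |1 / (p:ℝ)| < 1 := by
    rw [abs_of_nonneg (by positivity), div_lt_one (by linarith)]; linarith
  have hF1 : Summable (fun k => F (k+1)) := by
    have := summable_pow_mul_geometric_of_norm_lt_one l (r := 1 / (p:ℝ)) (by rwa [Real.norm_eq_abs])
    have := ((summable_nat_add_iff 1).2 this).mul_left (|K| + 1)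
    refine Summable.of_norm_bounded this fun k => ?_
    have hb := f_bd hp1 h hp k
    simp only [hF]
    rw [norm_div, norm_pow, Complex.norm_natCast, one_div, inv_pow, ← mul_assoc, div_eq_mul_inv]
    push_cast
    gcongr
  have hF0 : F 0 = 0 := by simp [hF, f_one hadd]
  have hFs : Summable F := (summable_nat_add_iff 1).1 hF1
  have hsum : ∑' k, F k = ∑' k, F (k+1) := by rw [hFs.tsum_eq_zero_add, hF0, zero_add]
  have hlog := (Complex.hasSum_ofReal.2 (Real.hasSum_pow_div_log_of_abs_lt_one hx))
  have hG := (hF1.hasSum.sub (hFs.hasSum.mul_left (1 / (p:ℂ)))).sub hlog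
  rw [hsum] at hG
  have e : (fun k : ℕ => ee f (p ^ (k+1)) / ((p ^ (k+1) : ℕ) : ℂ)) = fun k : ℕ => F (k+1) - 1 / (p:ℂ) * F k - (((1 / (p:ℝ)) ^ (k+1) / ((k:ℝ)+1) : ℝ) : ℂ) := by
    funext k
    have hk : (k:ℂ) + 1 ≠ 0 := by exact_mod_cast k.succ_ne_zero
    rw [ee_pp f hp]
    simp only [hF]
    push_cast
    rw [div_pow, one_pow]
    field_simp
    ring
  rw [e, hG.tsum_eq]
  push_cast
  ring

lemma ee_tsum {f : ℕ → ℂ} (hadd : ∀ m n : ℕ, Nat.Coprime m n → f (m * n) = f m + f n) (hp1 : ∀ p : ℕ, p.Prime → f p = 1) {l : ℕ} {K : ℝ} (h : ∀ p : ℕ, p.Prime → ∀ ν : ℕ, 2 ≤ ν → ‖f (p ^ ν)‖ ≤ K * (ν : ℝ) ^ l) :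
    Summable (fun p : Nat.Primes => ‖(Real.log (1 - 1 / ((p:ℕ) : ℝ)) : ℂ) + (1 - 1 / ((p:ℕ) : ℂ)) * ∑' ν : ℕ, f ((p:ℕ) ^ (ν + 1)) / ((p:ℕ) : ℂ) ^ (ν + 1)‖) ∧
    ∑' q : ℕ, ee f q / q = ∑' p : Nat.Primes, ((Real.log (1 - 1 / ((p:ℕ) : ℝ)) : ℂ) + (1 - 1 / ((p:ℕ) : ℂ)) * ∑' ν : ℕ, f ((p:ℕ) ^ (ν + 1)) / ((p:ℕ) : ℂ) ^ (ν + 1)) := by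
  have hs := ee_norm_summable (ee_summable hadd hp1 h)
  have hinj : Function.Injective (fun z : Nat.Primes × ℕ => (z.1:ℕ) ^ (z.2+1)) :=
    Subtype.val_injective.comp Nat.Primes.prodNatEquiv.injective
  have h2 : Summable (fun z : Nat.Primes × ℕ => ‖ee f ((z.1:ℕ) ^ (z.2+1)) / (((z.1:ℕ) ^ (z.2+1) : ℕ) : ℂ)‖) := hs.comp_injective hinj
  constructor
  · refine Summable.of_nonneg_of_le (fun _ => norm_nonneg _) (fun p => ?_) h2.prod
    rw [← ee_inner hadd hp1 h p.2]
    exact norm_tsum_le_tsum_norm (h2.prod_factor p)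
  · rw [tsum_eq_tsum_primes_of_support_subset_prime_powers hs.of_norm]
    · exact tsum_congr fun p => ee_inner hadd hp1 h p.2
    · intro q hq
      by_contra hn
      exact hq (by show ee f q / q = 0; rw [ee_of_not f hn, zero_div])

end

/-- **Mean value of functions in the class `F₀`** (Theorem `Th_f_additive`).
`F₀` is the class of additive `f : ℕ → ℂ` with `f p = 1` for every prime `p`
and `|f (p^ν)| ≤ K ν^ℓ` uniformly for primes `p` and `ν ≥ 2`.
For such `f` and every fixed `N ≥ 1`,
`Σ_{n ≤ x} f n = x log log x + C_f x + x Σ_{j=1}^N a_j/(log x)^j + O(x/(log x)^{N+1})`,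
where `C_f = γ + Σ_p (log(1 − 1/p) + (1 − 1/p) Σ_{ν ≥ 1} f(p^ν)/p^ν)`
(a series over primes, absolutely convergent) and
`a_j = −∫_1^∞ (t − ⌊t⌋)(log t)^{j−1}/t² dt`. -/
theorem stmt_8 (f : ℕ → ℂ)
    (hadd : ∀ m n : ℕ, Nat.Coprime m n → f (m * n) = f m + f n)
    (hp1 : ∀ p : ℕ, p.Prime → f p = 1)
    (hbound : ∃ (l : ℕ) (K : ℝ), ∀ p : ℕ, p.Prime → ∀ ν : ℕ, 2 ≤ ν →
      ‖f (p ^ ν)‖ ≤ K * (ν : ℝ) ^ l)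
    (N : ℕ) (hN : 1 ≤ N) :
    Summable (fun p : Nat.Primes =>
      ‖(Real.log (1 - 1 / ((p : ℕ) : ℝ)) : ℂ) +
        (1 - 1 / ((p : ℕ) : ℂ)) *
          ∑' ν : ℕ, f ((p : ℕ) ^ (ν + 1)) / ((p : ℕ) : ℂ) ^ (ν + 1)‖) ∧
    ∃ c > (0 : ℝ), ∃ x₀ : ℝ, 3 ≤ x₀ ∧ ∀ x ≥ x₀,
      ‖(∑ n ∈ Finset.Icc 1 ⌊x⌋₊, f n) -
        (((x * Real.log (Real.log x) : ℝ) : ℂ) +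
          ((Real.eulerMascheroniConstant : ℂ) +
            ∑' p : Nat.Primes,
              ((Real.log (1 - 1 / ((p : ℕ) : ℝ)) : ℂ) +
                (1 - 1 / ((p : ℕ) : ℂ)) *
                  ∑' ν : ℕ, f ((p : ℕ) ^ (ν + 1)) / ((p : ℕ) : ℂ) ^ (ν + 1))) * (x : ℂ) +
          (x : ℂ) *
            ((∑ j ∈ Finset.Icc 1 N,
              (-∫ t in Set.Ioi (1 : ℝ),
                  (t - (⌊t⌋₊ : ℝ)) * (Real.log t) ^ (j - 1) / t ^ 2) /
                (Real.log x) ^ j : ℝ) : ℂ))‖ ≤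
        c * x / (Real.log x) ^ (N + 1) := by
  obtain ⟨l, K, hK⟩ := hbound
  obtain ⟨hs, ht⟩ := ee_tsum hadd hp1 hK
  refine ⟨hs, ?_⟩
  rw [← ht]
  have hsum := ee_summable hadd hp1 hK
  obtain ⟨C, hC, x₀, hx₀, H⟩ := CC_asym N
  set S := ∑' q : ℕ, ‖ee f q‖ * (q : ℝ) ^ (-(3/4) : ℝ) with hS
  have hS0 : 0 ≤ S := tsum_nonneg fun q => by positivity
  refine ⟨C + 4 ^ (N+1) * (N+1).factorial * S, by positivity, x₀, hx₀, fun x hx => ?_⟩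
  have hx3 : 3 ≤ x := hx₀.trans hx
  have hx0 : 0 < x := by linarith
  have hl : 0 < Real.log x := log_pos2 (by linarith)
  have h1 := H x hx
  have h2 := ee_sum_asym hsum hx0
  rw [← hS] at h2
  rw [DD_eq] at h1
  have e1 : ∑ n ∈ Finset.Icc 1 ⌊x⌋₊, f n = ∑ q ∈ Finset.Icc 1 ⌊x⌋₊, ee f q * (⌊x / q⌋₊ : ℂ)
      + ((∑ n ∈ Finset.Icc 1 ⌊x⌋₊, cc n * (⌊x / n⌋₊ : ℝ) : ℝ) : ℂ) := by
    rw [sum_f hadd]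
    push_cast
    rw [← Finset.sum_add_distrib]
    exact Finset.sum_congr rfl fun q _ => by rw [ee]; ring
  have e2 : ∑ j ∈ Finset.Icc 1 N,
              (-∫ t in Set.Ioi (1 : ℝ),
                  (t - (⌊t⌋₊ : ℝ)) * (Real.log t) ^ (j - 1) / t ^ 2) /
                (Real.log x) ^ j = - ∑ j ∈ Finset.Icc 1 N, II j / Real.log x ^ j := by
    rw [← Finset.sum_neg_distrib]
    exact Finset.sum_congr rfl fun j _ => by rw [II, neg_div]
  rw [e1, e2]
  generalize ∑ n ∈ Finset.Icc 1 ⌊x⌋₊, cc n * (⌊x / n⌋₊ : ℝ) = A at *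
  generalize ∑ j ∈ Finset.Icc 1 N, II j / Real.log x ^ j = B at *
  generalize ∑ q ∈ Finset.Icc 1 ⌊x⌋₊, ee f q * (⌊x / q⌋₊ : ℂ) = E at *
  generalize ∑' q : ℕ, ee f q / q = Z at *
  have h3 : x ^ (3/4:ℝ) * S ≤ 4 ^ (N+1) * (N+1).factorial * S * x / Real.log x ^ (N+1) := by
    rw [le_div_iff₀ (by positivity)]
    calc x ^ (3/4:ℝ) * S * Real.log x ^ (N+1)
        ≤ x ^ (3/4:ℝ) * S * (4 ^ (N+1) * (N+1).factorial * x ^ (1/4:ℝ)) := by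
          gcongr
          exact log_pow_le (N+1) (by linarith)
      _ = 4 ^ (N+1) * (N+1).factorial * S * (x ^ (3/4:ℝ) * x ^ (1/4:ℝ)) := by ring
      _ = _ := by rw [← Real.rpow_add hx0]; norm_num
  have e3 : E + (A:ℂ) - (((x * Real.log (Real.log x) : ℝ) : ℂ) + ((Real.eulerMascheroniConstant : ℂ) + Z) * (x:ℂ) + (x:ℂ) * ((-B : ℝ) : ℂ))
      = (E - x * Z) + ((A - (x * Real.log (Real.log x) + x * Real.eulerMascheroniConstant - x * B) : ℝ) : ℂ) := by
    push_cast; ring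
  rw [e3]
  refine (norm_add_le _ _).trans ?_
  rw [Complex.norm_real, Real.norm_eq_abs, add_mul, add_div]
  linarith
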